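/- arXiv:1812.09995 — 5 statements merged into one kernel-verified Lean document; each statement's English description precedes it below -/
import Mathlib

section
/- Let A be an approximately unital Jordan operator algebra, with real positive cone 𝔯_A = {x ∈ A : x + x* ≥ 0}, and let 𝔠_{A*} = {φ ∈ A* : Re φ(x) ≥ 0 for all x ∈ 𝔯_A}. Then the norm is additive on 𝔠_{A*}: for all φ, ψ ∈ 𝔠_{A*}, ‖φ + ψ‖ = ‖φ‖ + ‖ψ‖. -/
/-- A net `(e i)` indexed by a filter is a Jordan contractive approximate identity
for a subspace `A ⊆ B(H)`. -/
def IsJCai4 {H : Type*} [NormedAddCommGroup H] [InnerProductSpace ℂ H]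
    (A : Submodule ℂ (H →L[ℂ] H)) {ι : Type*} (l : Filter ι) (e : ι → ↥A) : Prop :=
  l.NeBot ∧ (∀ i, ‖e i‖ ≤ 1) ∧
    ∀ a : ↥A, Filter.Tendsto
      (fun i => ((1 : ℂ) / 2) • ((e i : H →L[ℂ] H) * a + (a : H →L[ℂ] H) * (e i : H →L[ℂ] H)))
      l (nhds (a : H →L[ℂ] H))

open Filter Topology ContinuousLinearMap

section JordanApproximateIdentity

variable {H : Type*} [NormedAddCommGroup H] [InnerProductSpace ℂ H] {A : Submodule ℂ (H →L[ℂ] H)}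
  {ι : Type*} {l : Filter ι} {e : ι → ↥A}

namespace IsJCai4

theorem tendsto_mul_add_mul (h : IsJCai4 A l e) {a : H →L[ℂ] H} (ha : a ∈ A) :
    Tendsto (fun i => (e i : H →L[ℂ] H) * a + a * (e i : H →L[ℂ] H)) l (𝓝 ((2 : ℂ) • a)) := by
  have := (h.2.2 ⟨a, ha⟩).const_smul (2 : ℂ)
  simp only [smul_smul] at this
  norm_num at this
  exact this

/-- A Jordan approximate identity is a two-sided approximate identity on squares. -/
theorem tendsto_mul_self (h : IsJCai4 A l e) (hsq : ∀ a ∈ A, a * a ∈ A)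
    {a : H →L[ℂ] H} (ha : a ∈ A) :
    Tendsto (fun i => (e i : H →L[ℂ] H) * (a * a)) l (𝓝 (a * a)) ∧
      Tendsto (fun i => (a * a) * (e i : H →L[ℂ] H)) l (𝓝 (a * a)) := by
  have h1 := h.tendsto_mul_add_mul ha
  have h2 := h.tendsto_mul_add_mul (hsq a ha)
  have hl := h1.const_mul a
  have hr := h1.mul_const a
  have key : ∀ X : H →L[ℂ] H, (1 / 2 : ℂ) • (X + X) = X := fun X => by
    rw [← two_smul ℂ X, smul_smul]; norm_num
  constructor
  · convert ((hr.sub hl).add h2).const_smul (1 / 2 : ℂ) using 2 with i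
    · conv_lhs => rw [← key ((e i : H →L[ℂ] H) * (a * a))]
      congr 1
      noncomm_ring
    · rw [two_smul, two_smul, add_mul, mul_add, sub_self, zero_add, key]
  · convert ((hl.sub hr).add h2).const_smul (1 / 2 : ℂ) using 2 with i
    · conv_lhs => rw [← key ((a * a) * (e i : H →L[ℂ] H))]
      congr 1
      noncomm_ring
    · rw [two_smul, two_smul, add_mul, mul_add, sub_self, zero_add, key]

/-- A Jordan contractive approximate identity is a two-sided approximate identity
for the associative product. -/
theorem tendsto_mul (h : IsJCai4 A l e) (hsq : ∀ a ∈ A, a * a ∈ A)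
    {a : H →L[ℂ] H} (ha : a ∈ A) :
    Tendsto (fun i => (e i : H →L[ℂ] H) * a) l (𝓝 a) ∧
      Tendsto (fun i => a * (e i : H →L[ℂ] H)) l (𝓝 a) := by
  have := h.1
  have jordan : ∀ b ∈ A,
      Tendsto (fun i => (e i : H →L[ℂ] H) * (b * a + a * b)) l (𝓝 (b * a + a * b)) ∧
      Tendsto (fun i => (b * a + a * b) * (e i : H →L[ℂ] H)) l (𝓝 (b * a + a * b)) := by
    intro b hb
    have h1 := h.tendsto_mul_self hsq (A.add_mem hb ha)
    have h2 := h.tendsto_mul_self hsq hb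
    have h3 := h.tendsto_mul_self hsq ha
    have e1 : b * a + a * b = (b + a) * (b + a) - b * b - a * a := by noncomm_ring
    rw [e1]
    simp only [mul_sub, sub_mul]
    exact ⟨(h1.1.sub h2.1).sub h3.1, (h1.2.sub h2.2).sub h3.2⟩
  have approx : ∀ ε > 0, ∃ c : H →L[ℂ] H, ‖a - c‖ ≤ ε ∧
      Tendsto (fun i => (e i : H →L[ℂ] H) * c) l (𝓝 c) ∧
      Tendsto (fun i => c * (e i : H →L[ℂ] H)) l (𝓝 c) := by
    intro ε hε
    obtain ⟨i, hi⟩ := ((Metric.tendsto_nhds.1 (h.2.2 ⟨a, ha⟩)) ε hε).exists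
    obtain ⟨j1, j2⟩ := jordan (e i) (e i).2
    refine ⟨(1 / 2 : ℂ) • ((e i : H →L[ℂ] H) * a + a * (e i : H →L[ℂ] H)), ?_, ?_, ?_⟩
    · rw [dist_comm, dist_eq_norm] at hi
      exact hi.le
    · simpa only [mul_smul_comm] using j1.const_smul (1 / 2 : ℂ)
    · simpa only [smul_mul_assoc] using j2.const_smul (1 / 2 : ℂ)
  constructor
  · refine Metric.tendsto_nhds.2 fun ε hε => ?_
    obtain ⟨c, hc, h1, -⟩ := approx (ε / 4) (by positivity)
    filter_upwards [Metric.tendsto_nhds.1 h1 (ε / 4) (by positivity)] with i hi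
    rw [dist_eq_norm] at hi ⊢
    have e1 : (e i : H →L[ℂ] H) * a - a = e i * (a - c) + ((e i : H →L[ℂ] H) * c - c) - (a - c) := by
      noncomm_ring
    have e2 : ‖(e i : H →L[ℂ] H) * (a - c)‖ ≤ 1 * ‖a - c‖ :=
      (norm_mul_le _ _).trans (mul_le_mul_of_nonneg_right (h.2.1 i) (norm_nonneg _))
    rw [e1]
    linarith [norm_sub_le ((e i : H →L[ℂ] H) * (a - c) + ((e i : H →L[ℂ] H) * c - c)) (a - c),
      norm_add_le ((e i : H →L[ℂ] H) * (a - c)) ((e i : H →L[ℂ] H) * c - c)]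
  · refine Metric.tendsto_nhds.2 fun ε hε => ?_
    obtain ⟨c, hc, -, h1⟩ := approx (ε / 4) (by positivity)
    filter_upwards [Metric.tendsto_nhds.1 h1 (ε / 4) (by positivity)] with i hi
    rw [dist_eq_norm] at hi ⊢
    have e1 : a * (e i : H →L[ℂ] H) - a = (a - c) * e i + (c * (e i : H →L[ℂ] H) - c) - (a - c) := by
      noncomm_ring
    have e2 : ‖(a - c) * (e i : H →L[ℂ] H)‖ ≤ ‖a - c‖ * 1 :=
      (norm_mul_le _ _).trans (mul_le_mul_of_nonneg_left (h.2.1 i) (norm_nonneg _))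
    rw [e1]
    linarith [norm_sub_le ((a - c) * (e i : H →L[ℂ] H) + (c * (e i : H →L[ℂ] H) - c)) (a - c),
      norm_add_le ((a - c) * (e i : H →L[ℂ] H)) (c * (e i : H →L[ℂ] H) - c)]

end IsJCai4

variable [CompleteSpace H]

/-- A contraction which almost fixes the range of `a` has an adjoint which does so as well. -/
theorem norm_star_mul_sub_self_sq_le {e a : H →L[ℂ] H} (he : ‖e‖ ≤ 1) :
    ‖star e * a - a‖ ^ 2 ≤ 2 * (‖e * a - a‖ * ‖a‖) := by
  have hb : ‖star e * a - a‖ ≤ √(2 * (‖e * a - a‖ * ‖a‖)) := by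
    refine opNorm_le_bound _ (Real.sqrt_nonneg _) fun x => ?_
    refine le_of_sq_le_sq ?_ (by positivity)
    rw [mul_pow, Real.sq_sqrt (by positivity)]
    have h1 : ‖(star e * a - a) x‖ ^ 2
        = ‖(star e) (a x)‖ ^ 2 - 2 * (inner ℂ (star e (a x)) (a x)).re + ‖a x‖ ^ 2 := by
      simpa using norm_sub_sq (𝕜 := ℂ) (star e (a x)) (a x)
    have h2 : ‖(star e) (a x)‖ ≤ ‖a x‖ := by
      simpa only [one_mul] using le_of_opNorm_le _ ((norm_star e).trans_le he) (a x)
    have h3 : inner ℂ (star e (a x)) (a x) = inner ℂ (a x) (e (a x)) := by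
      rw [star_eq_adjoint, adjoint_inner_left]
    have h4 : (inner ℂ (a x) (e (a x))).re
        = ‖a x‖ ^ 2 + (inner ℂ (a x) ((e * a - a) x)).re := by
      have : ((e * a - a) x) = e (a x) - a x := rfl
      rw [this, inner_sub_right, Complex.sub_re]
      have := inner_self_eq_norm_sq (𝕜 := ℂ) (a x)
      simp only [RCLike.re_to_complex] at this
      linarith
    have h5 : -(inner ℂ (a x) ((e * a - a) x)).re ≤ ‖a x‖ * ‖(e * a - a) x‖ :=
      (neg_le_abs _).trans ((Complex.abs_re_le_norm _).trans (norm_inner_le_norm _ _))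
    have h6 : ‖a x‖ * ‖(e * a - a) x‖ ≤ (‖a‖ * ‖x‖) * (‖e * a - a‖ * ‖x‖) := by
      gcongr <;> exact le_opNorm _ _
    have h7 : ‖(star e) (a x)‖ ^ 2 ≤ ‖a x‖ ^ 2 := by gcongr
    rw [h1, h3, h4]
    nlinarith
  calc _ ≤ √(2 * (‖e * a - a‖ * ‖a‖)) ^ 2 := by gcongr
    _ = _ := Real.sq_sqrt (by positivity)

namespace IsJCai4

theorem tendsto_star_mul (h : IsJCai4 A l e) (hsq : ∀ a ∈ A, a * a ∈ A)
    {a : H →L[ℂ] H} (ha : a ∈ A) :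
    Tendsto (fun i => star (e i : H →L[ℂ] H) * a) l (𝓝 a) := by
  rw [tendsto_iff_norm_sub_tendsto_zero]
  have h1 := tendsto_iff_norm_sub_tendsto_zero.1 (h.tendsto_mul hsq ha).1
  have h2 : Tendsto (fun i => √(2 * (‖(e i : H →L[ℂ] H) * a - a‖ * ‖a‖))) l (𝓝 0) := by
    simpa using ((h1.mul_const ‖a‖).const_mul 2).sqrt
  exact squeeze_zero (fun _ => norm_nonneg _)
    (fun i => Real.le_sqrt_of_sq_le (norm_star_mul_sub_self_sq_le (h.2.1 i))) h2

/-- Sums `S` of `n` successively chosen members of the approximate identity satisfy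
`S* S ≤ Re T + 2 n` with `T ∈ A` of norm at most `n (n - 1)`, while `S / n` still acts as an
approximate unit on two given elements. -/
theorem exists_sum (h : IsJCai4 A l e) (hsq : ∀ a ∈ A, a * a ∈ A)
    {a b : H →L[ℂ] H} (ha : a ∈ A) (hb : b ∈ A) {ε : ℝ} (hε : 0 < ε) (n : ℕ) :
    ∃ S ∈ A, ∃ T ∈ A, ‖S‖ ≤ n ∧ ‖T‖ ≤ n * (n - 1) ∧
      (∀ x, ‖S x‖ ^ 2 ≤ (inner ℂ x (T x)).re + 2 * n * ‖x‖ ^ 2) ∧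
      ∀ d, d = a ∨ d = b →
        ‖d * S - (n : ℂ) • d‖ ≤ n * ε ∧ ‖star S * d - (n : ℂ) • d‖ ≤ n * ε := by
  have := h.1
  induction n with
  | zero => exact ⟨0, A.zero_mem, 0, A.zero_mem, by simp⟩
  | succ n ih =>
    obtain ⟨S, hS, T, hT, hSn, hTn, hST, hd⟩ := ih
    have ev : ∀ d ∈ A, ∀ᶠ i in l, ‖d * (e i : H →L[ℂ] H) - d‖ ≤ ε ∧
        ‖star (e i : H →L[ℂ] H) * d - d‖ ≤ ε := by
      intro d hdA
      filter_upwards [Metric.tendsto_nhds.1 (h.tendsto_mul hsq hdA).2 ε hε,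
        Metric.tendsto_nhds.1 (h.tendsto_star_mul hsq hdA) ε hε] with i h1 h2
      rw [dist_eq_norm] at h1 h2
      exact ⟨h1.le, h2.le⟩
    obtain ⟨i, hia, hib, hiS⟩ := ((ev a ha).and ((ev b hb).and
      (Metric.tendsto_nhds.1 (h.tendsto_star_mul hsq hS) (1 / 2) (by norm_num)))).exists
    rw [dist_eq_norm] at hiS
    have hei : ‖(e i : H →L[ℂ] H)‖ ≤ 1 := h.2.1 i
    generalize hu : (e i : H →L[ℂ] H) = u at *
    have huA : u ∈ A := hu ▸ (e i).2
    refine ⟨S + u, A.add_mem hS huA, T + (2 : ℂ) • S, A.add_mem hT (A.smul_mem _ hS), ?_, ?_, ?_, ?_⟩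
    · push_cast
      linarith [norm_add_le S u]
    · have h1 := norm_add_le T ((2 : ℂ) • S)
      rw [norm_smul, Complex.norm_ofNat] at h1
      push_cast
      nlinarith
    · intro x
      have h1 : ‖(S + u) x‖ ^ 2 = ‖S x‖ ^ 2 + 2 * (inner ℂ (u x) (S x)).re + ‖u x‖ ^ 2 := by
        have := norm_add_sq (𝕜 := ℂ) (u x) (S x)
        rw [RCLike.re_to_complex] at this
        rw [add_apply, add_comm (S x), this]
        ring
      have h2 : ‖u x‖ ≤ ‖x‖ := by simpa using u.le_of_opNorm_le hei x
      have h3 : (inner ℂ (u x) (S x)).re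
          = (inner ℂ x (S x)).re + (inner ℂ x ((star u * S - S) x)).re := by
        rw [← Complex.add_re, ← inner_add_right]
        simp [star_eq_adjoint, adjoint_inner_right]
      have h4 : (inner ℂ x ((star u * S - S) x)).re ≤ ‖x‖ * (1 / 2 * ‖x‖) :=
        (Complex.re_le_norm _).trans ((norm_inner_le_norm _ _).trans
          (mul_le_mul_of_nonneg_left (le_of_opNorm_le _ hiS.le x) (norm_nonneg _)))
      have h5 : (inner ℂ x ((T + (2 : ℂ) • S) x)).re
          = (inner ℂ x (T x)).re + 2 * (inner ℂ x (S x)).re := by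
        simp
      have h6 : ‖u x‖ ^ 2 ≤ ‖x‖ ^ 2 := by gcongr
      rw [h1, h3, h5]
      rw [Nat.cast_succ]
      nlinarith [hST x]
    · intro d hdab
      obtain ⟨h1, h2⟩ := hd d hdab
      obtain ⟨h3, h4⟩ : ‖d * u - d‖ ≤ ε ∧ ‖star u * d - d‖ ≤ ε := by
        rcases hdab with rfl | rfl
        exacts [hia, hib]
      have e1 : d * (S + u) - ((n + 1 : ℕ) : ℂ) • d = (d * S - (n : ℂ) • d) + (d * u - d) := by
        push_cast
        rw [add_smul, one_smul, mul_add]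
        abel
      have e2 : star (S + u) * d - ((n + 1 : ℕ) : ℂ) • d
          = (star S * d - (n : ℂ) • d) + (star u * d - d) := by
        push_cast
        rw [add_smul, one_smul, star_add, add_mul]
        abel
      rw [e1, e2]
      push_cast
      constructor
      · linarith [norm_add_le (d * S - (n : ℂ) • d) (d * u - d)]
      · linarith [norm_add_le (star S * d - (n : ℂ) • d) (star u * d - d)]

/-- There are contractions `c ∈ A` and `f` such that `f* f ≤ Re c + δ` and `f* d f` is close to `d`
for two given elements `d` of `A`. -/
theorem exists_sq_le (h : IsJCai4 A l e) (hsq : ∀ a ∈ A, a * a ∈ A)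
    {a b : H →L[ℂ] H} (ha : a ∈ A) (hb : b ∈ A) {δ : ℝ} (hδ : 0 < δ) :
    ∃ c ∈ A, ∃ f : H →L[ℂ] H, ‖c‖ ≤ 1 ∧
      (∀ x, ‖f x‖ ^ 2 ≤ (inner ℂ x (c x)).re + δ * ‖x‖ ^ 2) ∧
      ∀ d, d = a ∨ d = b → ‖star f * d * f - d‖ ≤ δ := by
  obtain ⟨n, hn⟩ := exists_nat_gt (2 / δ)
  have hn0 : (0 : ℝ) < n := (by positivity : (0 : ℝ) < 2 / δ).trans hn
  have hn0' : (n : ℂ) ≠ 0 := by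
    intro h0
    have : n = 0 := by exact_mod_cast h0
    simp [this] at hn0
  obtain ⟨S, -, T, hT, hSn, hTn, hST, hd⟩ := h.exists_sum hsq ha hb (half_pos hδ) n
  have hcast : ((n : ℂ) ^ 2)⁻¹ = (((n : ℝ) ^ 2)⁻¹ : ℝ) := by push_cast; rfl
  refine ⟨((n : ℂ) ^ 2)⁻¹ • T, A.smul_mem _ hT, (n : ℂ)⁻¹ • S, ?_, ?_, ?_⟩
  · rw [norm_smul, norm_inv, norm_pow, Complex.norm_natCast, inv_mul_le_iff₀ (by positivity)]
    nlinarith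
  · intro x
    have h1 : ‖((n : ℂ)⁻¹ • S) x‖ ^ 2 = ((n : ℝ) ^ 2)⁻¹ * ‖S x‖ ^ 2 := by
      rw [smul_apply, norm_smul, norm_inv, Complex.norm_natCast, mul_pow, inv_pow]
    have h2 : (inner ℂ x ((((n : ℂ) ^ 2)⁻¹ • T) x)).re
        = ((n : ℝ) ^ 2)⁻¹ * (inner ℂ x (T x)).re := by
      rw [smul_apply, inner_smul_right, hcast, Complex.re_ofReal_mul]
    rw [h1, h2]
    have h3 : ((n : ℝ) ^ 2)⁻¹ * (2 * n) ≤ δ := by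
      rw [inv_mul_le_iff₀ (by positivity)]
      rw [div_lt_iff₀ hδ] at hn
      nlinarith
    calc _ ≤ ((n : ℝ) ^ 2)⁻¹ * ((inner ℂ x (T x)).re + 2 * n * ‖x‖ ^ 2) := by
          gcongr
          exact hST x
      _ = ((n : ℝ) ^ 2)⁻¹ * (inner ℂ x (T x)).re + (((n : ℝ) ^ 2)⁻¹ * (2 * n)) * ‖x‖ ^ 2 := by ring
      _ ≤ _ := by gcongr
  · intro d hdab
    obtain ⟨h1, h2⟩ := hd d hdab
    set f : H →L[ℂ] H := (n : ℂ)⁻¹ • S with hf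
    have hfn : ‖f‖ ≤ 1 := by
      rw [hf, norm_smul, norm_inv, Complex.norm_natCast, inv_mul_le_iff₀ hn0]
      linarith
    have e1 : d * f - d = (n : ℂ)⁻¹ • (d * S - (n : ℂ) • d) := by
      rw [smul_sub, smul_smul, inv_mul_cancel₀ hn0', one_smul, hf, mul_smul_comm]
    have e2 : star f * d - d = (n : ℂ)⁻¹ • (star S * d - (n : ℂ) • d) := by
      rw [smul_sub, smul_smul, inv_mul_cancel₀ hn0', one_smul, hf, star_smul, smul_mul_assoc]
      simp
    have n1 : ‖d * f - d‖ ≤ δ / 2 := by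
      rw [e1, norm_smul, norm_inv, Complex.norm_natCast, inv_mul_le_iff₀ hn0]
      exact h1
    have n2 : ‖star f * d - d‖ ≤ δ / 2 := by
      rw [e2, norm_smul, norm_inv, Complex.norm_natCast, inv_mul_le_iff₀ hn0]
      exact h2
    have e3 : star f * d * f - d = star f * (d * f - d) + (star f * d - d) := by noncomm_ring
    have n3 : ‖star f * (d * f - d)‖ ≤ 1 * (δ / 2) :=
      (norm_mul_le _ _).trans (mul_le_mul (by rwa [norm_star]) n1 (norm_nonneg _) zero_le_one)
    rw [e3]
    linarith [norm_add_le (star f * (d * f - d)) (star f * d - d)]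

/-- If `Re d ≥ -r` for two elements `d ∈ A`, then `Re (d + r c) ≥ -r δ` for a common contraction
`c ∈ A`. -/
theorem exists_add_re_inner_ge (h : IsJCai4 A l e) (hsq : ∀ a ∈ A, a * a ∈ A)
    {a b : H →L[ℂ] H} (ha : a ∈ A) (hb : b ∈ A) {r δ : ℝ} (hr : 0 < r) (hδ : 0 < δ) :
    ∃ c ∈ A, ‖c‖ ≤ 1 ∧ ∀ d, d = a ∨ d = b → (∀ x, -r * ‖x‖ ^ 2 ≤ (inner ℂ x (d x)).re) →
      ∀ x, -(r * δ) * ‖x‖ ^ 2 ≤ (inner ℂ x ((d + (r : ℂ) • c) x)).re := by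
  have hη : 0 < r * δ / (r + 1) := by positivity
  obtain ⟨c, hc, f, hcn, hf, hd⟩ := h.exists_sq_le hsq ha hb hη
  refine ⟨c, hc, hcn, fun d hdab hdr x => ?_⟩
  have h1 := hdr (f x)
  have h2 : (inner ℂ (f x) (d (f x))).re
      = (inner ℂ x (d x)).re + (inner ℂ x ((star f * d * f - d) x)).re := by
    rw [← Complex.add_re, ← inner_add_right]
    simp [star_eq_adjoint, adjoint_inner_right]
  have h3 : (inner ℂ x ((star f * d * f - d) x)).re ≤ ‖x‖ * (r * δ / (r + 1) * ‖x‖) :=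
    (Complex.re_le_norm _).trans ((norm_inner_le_norm _ _).trans
      (mul_le_mul_of_nonneg_left (le_of_opNorm_le _ (hd d hdab) x) (norm_nonneg _)))
  have h4 : (inner ℂ x ((d + (r : ℂ) • c) x)).re
      = (inner ℂ x (d x)).re + r * (inner ℂ x (c x)).re := by
    simp
  have h5 := mul_le_mul_of_nonneg_left (hf x) hr.le
  have h6 : r * (r * δ / (r + 1)) * ‖x‖ ^ 2 + r * δ / (r + 1) * ‖x‖ ^ 2 = r * δ * ‖x‖ ^ 2 := by
    field_simp
  rw [h4]
  nlinarith

/-- An element of `A` with real part at least `-r` is within `2 r` of a real positive element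
of `A`. -/
theorem exists_accretive_near (h : IsJCai4 A l e) (hA : IsClosed (A : Set (H →L[ℂ] H)))
    (hsq : ∀ a ∈ A, a * a ∈ A) (a : A) {r : ℝ} (hr : 0 < r)
    (har : ∀ x, -r * ‖x‖ ^ 2 ≤ (inner ℂ x ((a : H →L[ℂ] H) x)).re) :
    ∃ b : A, ‖a - b‖ ≤ 2 * r ∧ ∀ x, 0 ≤ (inner ℂ x ((b : H →L[ℂ] H) x)).re := by
  have : CompleteSpace A := hA.completeSpace_coe
  have step : ∀ (n : ℕ) (a : {a : A //
      ∀ x, -(r / 2 ^ n) * ‖x‖ ^ 2 ≤ (inner ℂ x ((a : H →L[ℂ] H) x)).re}),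
      ∃ b : {b : A // ∀ x, -(r / 2 ^ (n + 1)) * ‖x‖ ^ 2 ≤ (inner ℂ x ((b : H →L[ℂ] H) x)).re},
        dist (a : A) (b : A) ≤ r / 2 ^ n := by
    rintro n ⟨a, ha⟩
    have hrn : 0 < r / 2 ^ n := by positivity
    obtain ⟨c, hc, hcn, hd⟩ := h.exists_add_re_inner_ge hsq a.2 a.2 hrn (one_half_pos (α := ℝ))
    refine ⟨⟨a + ((r / 2 ^ n : ℝ) : ℂ) • ⟨c, hc⟩, fun x => ?_⟩, ?_⟩
    · have := hd a (Or.inl rfl) ha x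
      rwa [show r / 2 ^ n * (1 / 2) = r / 2 ^ (n + 1) by rw [pow_succ]; field_simp] at this
    · rw [dist_self_add_right, norm_smul, Complex.norm_real, Real.norm_of_nonneg hrn.le]
      exact mul_le_of_le_one_right hrn.le hcn
  choose F hF using step
  obtain ⟨u, hu0, huF⟩ : ∃ u : ∀ n : ℕ, {a : A //
      ∀ x, -(r / 2 ^ n) * ‖x‖ ^ 2 ≤ (inner ℂ x ((a : H →L[ℂ] H) x)).re},
      (u 0 : A) = a ∧ ∀ n, u (n + 1) = F n (u n) :=
    ⟨fun n => Nat.rec ⟨a, by simpa using har⟩ F n, rfl, fun _ => rfl⟩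
  have hu : ∀ n, dist (u n : A) (u (n + 1) : A) ≤ 2 * r / 2 / 2 ^ n := fun n => by
    rw [mul_div_cancel_left₀ r two_ne_zero, huF]
    exact hF n (u n)
  obtain ⟨b, hb⟩ := cauchySeq_tendsto_of_complete (cauchySeq_of_le_geometric_two hu)
  refine ⟨b, ?_, fun x => ?_⟩
  · rw [← dist_eq_norm, ← hu0]
    exact dist_le_of_le_geometric_two_of_tendsto₀ hu hb
  · have hcont : Continuous fun b : A => (inner ℂ x ((b : H →L[ℂ] H) x)).re := by fun_prop
    have h1 : Tendsto (fun n : ℕ => -(r / 2 ^ n) * ‖x‖ ^ 2) atTop (𝓝 0) := by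
      have : Tendsto (fun n : ℕ => r * (1 / 2 : ℝ) ^ n) atTop (𝓝 (r * 0)) :=
        (tendsto_pow_atTop_nhds_zero_of_lt_one (by norm_num) (by norm_num)).const_mul r
      simpa [div_eq_mul_inv] using (this.neg.mul_const (‖x‖ ^ 2))
    exact le_of_tendsto_of_tendsto' h1 ((hcont.tendsto b).comp hb) fun n => (u n).2 x

/-- A real positive functional is bounded below on elements whose real part is bounded below. -/
theorem re_apply_ge (h : IsJCai4 A l e) (hA : IsClosed (A : Set (H →L[ℂ] H)))
    (hsq : ∀ a ∈ A, a * a ∈ A) {φ : ↥A →L[ℂ] ℂ}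
    (hφ : ∀ x : ↥A, ((x : H →L[ℂ] H) + star (x : H →L[ℂ] H)).IsPositive → 0 ≤ (φ x).re)
    (a : A) {r : ℝ} (hr : 0 < r)
    (har : ∀ x, -r * ‖x‖ ^ 2 ≤ (inner ℂ x ((a : H →L[ℂ] H) x)).re) :
    -(2 * r * ‖φ‖) ≤ (φ a).re := by
  obtain ⟨b, hab, hb⟩ := h.exists_accretive_near hA hsq a hr har
  have hpos : ((b : H →L[ℂ] H) + star (b : H →L[ℂ] H)).IsPositive := by
    rw [isPositive_def']
    refine ⟨IsSelfAdjoint.add_star_self _, fun x => ?_⟩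
    have h1 := hb x
    rw [reApplyInnerSelf_apply, add_apply, inner_add_left, star_eq_adjoint, adjoint_inner_left,
      map_add, inner_re_symm]
    simp only [RCLike.re_to_complex]
    linarith
  have h1 := hφ b hpos
  have h2 : -(φ (a - b)).re ≤ ‖φ‖ * (2 * r) :=
    (neg_le_abs _).trans ((Complex.abs_re_le_norm _).trans (φ.le_opNorm_of_le hab))
  rw [map_sub, Complex.sub_re] at h2
  linarith

end IsJCai4

end JordanApproximateIdentity

/-- The norm of a functional is approximated by the real part of its values on the unit ball. -/
theorem exists_norm_le_one_norm_sub_lt_re {E : Type*} [NormedAddCommGroup E] [NormedSpace ℂ E]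
    (φ : E →L[ℂ] ℂ) {ε : ℝ} (hε : 0 < ε) : ∃ x, ‖x‖ ≤ 1 ∧ ‖φ‖ - ε < (φ x).re := by
  obtain ⟨x, hx, hφx⟩ := φ.exists_lt_apply_of_lt_opNorm (sub_lt_self ‖φ‖ hε)
  obtain ⟨c, hc, hcx⟩ := Complex.exists_norm_eq_mul_self (φ x)
  refine ⟨c • x, by simpa [norm_smul, hc] using hx.le, ?_⟩
  rwa [map_smul, smul_eq_mul, ← hcx, Complex.ofReal_re]

/-- The norm on the dual of an approximately unital Jordan operator algebra is
additive on the cone of real positive functionals. -/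
theorem stmt4 {H : Type*} [NormedAddCommGroup H] [InnerProductSpace ℂ H] [CompleteSpace H]
    (A : Submodule ℂ (H →L[ℂ] H)) (hA : IsClosed (A : Set (H →L[ℂ] H)))
    (hsq : ∀ a ∈ A, a * a ∈ A)
    (hcai : ∃ (ι : Type) (l : Filter ι) (e : ι → ↥A), IsJCai4 A l e)
    (φ ψ : ↥A →L[ℂ] ℂ)
    (hφ : ∀ x : ↥A, ((x : H →L[ℂ] H) + star (x : H →L[ℂ] H)).IsPositive → 0 ≤ (φ x).re)
    (hψ : ∀ x : ↥A, ((x : H →L[ℂ] H) + star (x : H →L[ℂ] H)).IsPositive → 0 ≤ (ψ x).re) :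
    ‖φ + ψ‖ = ‖φ‖ + ‖ψ‖ := by
  refine le_antisymm (norm_add_le φ ψ) (le_of_forall_pos_le_add fun η hη => ?_)
  obtain ⟨ι, l, e, h⟩ := hcai
  have hK : 0 < 2 + 2 * ‖φ‖ + 2 * ‖ψ‖ := by positivity
  obtain ⟨ε, hε, hεη⟩ : ∃ ε > 0, ε * (2 + 2 * ‖φ‖ + 2 * ‖ψ‖) = η :=
    ⟨η / (2 + 2 * ‖φ‖ + 2 * ‖ψ‖), by positivity, div_mul_cancel₀ _ hK.ne'⟩
  obtain ⟨x, hx, hφx⟩ := exists_norm_le_one_norm_sub_lt_re φ hε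
  obtain ⟨y, hy, hψy⟩ := exists_norm_le_one_norm_sub_lt_re ψ hε
  obtain ⟨c, hc, hcn, hd⟩ :=
    h.exists_add_re_inner_ge hsq (-x).2 (-y).2 (one_pos (α := ℝ)) hε
  have key : ∀ z : A, ‖z‖ ≤ 1 → ∀ v,
      -1 * ‖v‖ ^ 2 ≤ (inner ℂ v (((-z : A) : H →L[ℂ] H) v)).re := by
    intro z hz v
    have h1 : (inner ℂ v ((z : H →L[ℂ] H) v)).re ≤ ‖v‖ * (1 * ‖v‖) :=
      (Complex.re_le_norm _).trans ((norm_inner_le_norm _ _).trans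
        (mul_le_mul_of_nonneg_left (le_of_opNorm_le _ hz v) (norm_nonneg _)))
    simp only [NegMemClass.coe_neg, neg_apply, inner_neg_right, Complex.neg_re]
    nlinarith
  have hφc := h.re_apply_ge hA hsq hφ (-x + ⟨c, hc⟩) hε fun v => by
    simpa using hd _ (Or.inl rfl) (key x hx) v
  have hψc := h.re_apply_ge hA hsq hψ (-y + ⟨c, hc⟩) hε fun v => by
    simpa using hd _ (Or.inr rfl) (key y hy) v
  have hsum : ((φ + ψ) ⟨c, hc⟩).re ≤ ‖φ + ψ‖ * 1 :=
    (Complex.re_le_norm _).trans ((φ + ψ).le_opNorm_of_le hcn)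
  simp only [map_add, map_neg, Complex.add_re, Complex.neg_re, add_apply] at hφc hψc hsum
  nlinarith
end

section
/- Let A be an approximately unital Jordan operator algebra, and define the preorder f ⪯ g on real-linear bounded functionals B(A, ℝ) by: g − f is nonnegative on the cone 𝔯_A of real positive elements. If f ⪯ g ⪯ h in B(A, ℝ), then ‖g‖ ≤ ‖f‖ + ‖h‖. -/
set_option synthInstance.maxHeartbeats 1000000
set_option maxHeartbeats 1000000

/-- A Jordan contractive approximate identity. -/
def IsJCai7 {H : Type*} [NormedAddCommGroup H] [InnerProductSpace ℂ H]
    (A : Submodule ℂ (H →L[ℂ] H)) {ι : Type*} (l : Filter ι) (e : ι → ↥A) : Prop :=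
  l.NeBot ∧ (∀ i, ‖e i‖ ≤ 1) ∧
    ∀ a : ↥A, Filter.Tendsto
      (fun i => ((1 : ℂ) / 2) • ((e i : H →L[ℂ] H) * a + (a : H →L[ℂ] H) * (e i : H →L[ℂ] H)))
      l (nhds (a : H →L[ℂ] H))

open Filter Topology

section HilbertEstimates
variable {H : Type*} [NormedAddCommGroup H] [InnerProductSpace ℂ H]

theorem norm_pow_le_one_of_norm_le_one {e : H →L[ℂ] H} (he : ‖e‖ ≤ 1) (n : ℕ) : ‖e ^ n‖ ≤ 1 := by
  induction n with
  | zero => exact ContinuousLinearMap.norm_id_le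
  | succ n ih =>
    rw [pow_succ]
    exact (norm_mul_le _ _).trans (mul_le_one₀ ih (norm_nonneg _) he)

theorem re_inner_one_sub_nonneg {e : H →L[ℂ] H} (he : ‖e‖ ≤ 1) (ζ : H) :
    0 ≤ (inner ℂ ((1 - e) ζ) ζ).re := by
  have h1 : ‖inner ℂ (e ζ) ζ‖ ≤ ‖ζ‖ * ‖ζ‖ :=
    (norm_inner_le_norm _ _).trans
      (mul_le_mul_of_nonneg_right (e.le_of_opNorm_le he ζ |>.trans_eq (one_mul _)) (norm_nonneg _))
  have h2 := (Complex.re_le_norm (inner ℂ (e ζ) ζ)).trans h1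
  have h3 : (inner ℂ ζ ζ : ℂ).re = ‖ζ‖ * ‖ζ‖ := by
    rw [← pow_two]; exact (norm_sq_eq_re_inner (𝕜 := ℂ) ζ).symm
  rw [sub_apply, inner_sub_left, Complex.sub_re, one_apply_eq_self]
  linarith

theorem norm_add_sq_of_accretive {d : H →L[ℂ] H} (hd : ∀ ζ, 0 ≤ (inner ℂ (d ζ) ζ).re) (ζ : H) :
    ‖ζ‖ ^ 2 + ‖d ζ‖ ^ 2 ≤ ‖(1 + d) ζ‖ ^ 2 := by
  have h := norm_add_sq (𝕜 := ℂ) (d ζ) ζ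
  have h' : (1 + d) ζ = d ζ + ζ := by simp [add_comm]
  have := hd ζ
  rw [h', h]
  simp only [RCLike.re_to_complex]
  linarith

theorem norm_pow_apply_sq_of_accretive {d : H →L[ℂ] H}
    (hd : ∀ ζ, 0 ≤ (inner ℂ (d ζ) ζ).re) (n : ℕ) (ζ : H) :
    ‖ζ‖ ^ 2 + n * ‖d ζ‖ ^ 2 ≤ ‖((1 + d) ^ n) ζ‖ ^ 2 := by
  induction n generalizing ζ with
  | zero => simp
  | succ n ih =>
    have h1 := ih ((1 + d) ζ)
    have h2 := norm_add_sq_of_accretive hd ζ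
    have h3 := norm_add_sq_of_accretive hd (d ζ)
    have h4 : d ((1 + d) ζ) = (1 + d) (d ζ) := by simp
    rw [h4] at h1
    rw [pow_succ (1 + d), mul_apply_eq_comp]
    have h5 : (n : ℝ) * ‖d ζ‖ ^ 2 ≤ n * ‖(1 + d) (d ζ)‖ ^ 2 :=
      mul_le_mul_of_nonneg_left (by nlinarith [sq_nonneg ‖d (d ζ)‖]) n.cast_nonneg
    rw [Nat.cast_succ]
    linarith

theorem sqrt_mul_norm_one_sub_mul_le {e : H →L[ℂ] H} (he : ‖e‖ ≤ 1) (a : H →L[ℂ] H) (n : ℕ) :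
    √n * ‖(1 - e) * a‖ ≤ ‖(2 - e) ^ n * a‖ := by
  rw [← Real.norm_of_nonneg (Real.sqrt_nonneg n), ← norm_smul]
  refine ContinuousLinearMap.opNorm_le_bound _ (norm_nonneg _) fun ξ => ?_
  refine le_trans ?_ (((2 - e) ^ n * a).le_opNorm ξ)
  refine abs_le_of_sq_le_sq' ?_ (norm_nonneg _) |>.2
  have h := norm_pow_apply_sq_of_accretive (re_inner_one_sub_nonneg he) n (a ξ)
  have h2 : (1 + (1 - e)) = 2 - e := by rw [← add_sub_assoc, one_add_one_eq_two]
  rw [h2] at h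
  rw [smul_apply, norm_smul, mul_pow, Real.norm_of_nonneg (Real.sqrt_nonneg n),
    Real.sq_sqrt n.cast_nonneg]
  exact (le_add_of_nonneg_left (sq_nonneg _)).trans h

theorem tendsto_one_sub_mul_of_jordan {ι : Type*} {l : Filter ι} {e : ι → H →L[ℂ] H}
    (he : ∀ i, ‖e i‖ ≤ 1) {a : H →L[ℂ] H}
    (h : Tendsto (fun i => (2 - e i) * a - a * e i) l (𝓝 0)) :
    Tendsto (fun i => (1 - e i) * a) l (𝓝 0) := by
  have hone : ‖(1 : H →L[ℂ] H)‖ ≤ 1 := ContinuousLinearMap.norm_id_le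
  have h2e : ∀ i, ‖2 - e i‖ ≤ 3 := fun i => by
    rw [← one_add_one_eq_two]
    linarith [norm_sub_le (1 + 1) (e i), norm_add_le (1 : H →L[ℂ] H) 1, he i]
  have hpow : ∀ n : ℕ, Tendsto (fun i => (2 - e i) ^ n * a - a * e i ^ n) l (𝓝 0) := by
    intro n
    induction n with
    | zero => simpa using tendsto_const_nhds
    | succ n ih =>
      rw [tendsto_zero_iff_norm_tendsto_zero] at ih h ⊢
      refine squeeze_zero (fun _ => norm_nonneg _) (fun i => ?_)
        (by simpa using (ih.const_mul 3).add h)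
      have : (2 - e i) ^ (n + 1) * a - a * e i ^ (n + 1) =
          (2 - e i) * ((2 - e i) ^ n * a - a * e i ^ n) + ((2 - e i) * a - a * e i) * e i ^ n := by
        rw [pow_succ', pow_succ']; noncomm_ring
      rw [this]
      refine (norm_add_le _ _).trans (add_le_add ?_ ?_)
      · exact (norm_mul_le _ _).trans (mul_le_mul_of_nonneg_right (h2e i) (norm_nonneg _))
      · exact (norm_mul_le _ _).trans (mul_le_of_le_one_right (norm_nonneg _) (norm_pow_le_one_of_norm_le_one (he i) n))
  rw [Metric.tendsto_nhds]
  intro δ hδ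
  obtain ⟨n, hn⟩ := exists_nat_gt (((‖a‖ + 1) / δ) ^ 2)
  filter_upwards [Metric.tendsto_nhds.1 (hpow n) 1 one_pos] with i hi
  rw [dist_zero_right] at hi ⊢
  have hb : ‖a * e i ^ n‖ ≤ ‖a‖ :=
    (norm_mul_le _ _).trans
      (mul_le_of_le_one_right (norm_nonneg _) (norm_pow_le_one_of_norm_le_one (he i) n))
  have h1 : ‖(2 - e i) ^ n * a‖ < ‖a‖ + 1 := by
    have := norm_le_norm_add_norm_sub' ((2 - e i) ^ n * a) (a * e i ^ n)
    linarith
  have h2 := sqrt_mul_norm_one_sub_mul_le (he i) a n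
  have h3 : (‖a‖ + 1) / δ < √n := Real.lt_sqrt_of_sq_lt hn
  rw [div_lt_iff₀ hδ] at h3
  by_contra! hc
  have := mul_le_mul_of_nonneg_left hc (Real.sqrt_nonneg n)
  linarith

variable [CompleteSpace H]

theorem norm_star_one_sub_mul_sq_le {e : H →L[ℂ] H} (he : ‖e‖ ≤ 1) (a : H →L[ℂ] H) :
    ‖star (1 - e) * a‖ ^ 2 ≤ 2 * ‖(1 - e) * a‖ * ‖a‖ := by
  have key : ‖star (1 - e) * a‖ ≤ √(2 * ‖(1 - e) * a‖ * ‖a‖) := by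
    refine ContinuousLinearMap.opNorm_le_bound _ (Real.sqrt_nonneg _) fun ξ => ?_
    refine abs_le_of_sq_le_sq' ?_ (by positivity) |>.2
    rw [mul_pow, Real.sq_sqrt (by positivity)]
    have h1 : ‖star e (a ξ)‖ ≤ ‖a ξ‖ :=
      ((star e).le_of_opNorm_le ((norm_star e).trans_le he) _).trans_eq (one_mul _)
    have h2 := norm_sub_sq (𝕜 := ℂ) (a ξ) (star e (a ξ))
    have h3 : inner ℂ (a ξ) (star e (a ξ)) = inner ℂ (e (a ξ)) (a ξ) := by
      rw [ContinuousLinearMap.star_eq_adjoint, ContinuousLinearMap.adjoint_inner_right]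
    have h4 : (star (1 - e) * a) ξ = a ξ - star e (a ξ) := by simp
    have h5 : (inner ℂ (((1 - e) * a) ξ) (a ξ)).re = ‖a ξ‖ ^ 2 - (inner ℂ (e (a ξ)) (a ξ)).re := by
      rw [mul_apply_eq_comp, sub_apply, inner_sub_left,
        Complex.sub_re, one_apply_eq_self]
      congr 1
      exact (norm_sq_eq_re_inner (𝕜 := ℂ) (a ξ)).symm
    have h6 : (inner ℂ (((1 - e) * a) ξ) (a ξ)).re ≤ (‖(1 - e) * a‖ * ‖ξ‖) * (‖a‖ * ‖ξ‖) :=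
      (Complex.re_le_norm _).trans <| (norm_inner_le_norm _ _).trans <|
        mul_le_mul (ContinuousLinearMap.le_opNorm _ _) (ContinuousLinearMap.le_opNorm _ _)
          (norm_nonneg _) (by positivity)
    rw [h4, h2, h3]
    simp only [RCLike.re_to_complex]
    have h7 : ‖star e (a ξ)‖ ^ 2 ≤ ‖a ξ‖ ^ 2 := by gcongr
    nlinarith
  calc _ ≤ (√(2 * ‖(1 - e) * a‖ * ‖a‖)) ^ 2 := by gcongr
    _ = _ := Real.sq_sqrt (by positivity)

theorem norm_mul_star_one_sub_sq_le {e : H →L[ℂ] H} (he : ‖e‖ ≤ 1) (a : H →L[ℂ] H) :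
    ‖a * star (1 - e)‖ ^ 2 ≤ 2 * ‖a * (1 - e)‖ * ‖a‖ := by
  have h := norm_star_one_sub_mul_sq_le (e := star e) (by rwa [norm_star]) (star a)
  have h1 : star (1 - star e) * star a = star (a * star (1 - e)) := by simp
  have h2 : (1 - star e) * star a = star (a * (1 - e)) := by simp
  rwa [h1, h2, norm_star, norm_star, norm_star] at h

theorem isPositive_add_star_of_norm_one_sub_le {z : H →L[ℂ] H} (hz : ‖1 - z‖ ≤ 1) :
    (z + star z).IsPositive := by
  have h := re_inner_one_sub_nonneg hz
  simp only [sub_sub_cancel] at h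
  refine ⟨(IsSelfAdjoint.add_star_self z).isSymmetric, fun ζ => ?_⟩
  have h3 : inner ℂ (star z ζ) ζ = inner ℂ ζ (z ζ) := by
    rw [ContinuousLinearMap.star_eq_adjoint, ContinuousLinearMap.adjoint_inner_left]
  have h4 : (inner ℂ ζ (z ζ)).re = (inner ℂ (z ζ) ζ).re := inner_re_symm (𝕜 := ℂ) _ _
  have h5 : (z + star z).reApplyInnerSelf ζ = (inner ℂ ((z + star z) ζ) ζ).re := rfl
  rw [h5, add_apply, inner_add_left, Complex.add_re, h3, h4]
  linarith [h ζ]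

end HilbertEstimates

theorem norm_ofReal_smul_one_le {E : Type*} [NormedRing E] [NormedAlgebra ℂ E]
    (hone : ‖(1 : E)‖ ≤ 1) {c : ℝ} (hc : 0 ≤ c) :
    ‖(c : ℂ) • (1 : E)‖ ≤ c := by
  rw [norm_smul, Complex.norm_of_nonneg hc]
  exact mul_le_of_le_one_right hc hone

section AlmostOrthogonal
variable {E : Type*} [NormedRing E] [StarRing E] [CStarRing E] [NormedAlgebra ℂ E] [StarModule ℂ E]
  {ι : Type*} {l : Filter ι}

theorem eventually_norm_add_lt_of_isSelfAdjoint (hone : ‖(1 : E)‖ ≤ 1) (m : ℕ) {c : ℝ}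
    (hc : 0 ≤ c) (hc1 : c ≤ 1) {a : E} {v : ι → E} (ha : IsSelfAdjoint a)
    (hv : ∀ i, IsSelfAdjoint (v i)) (hca : ‖(c : ℂ) • 1 + a‖ ≤ 1)
    (hcv : ∀ i, ‖(c : ℂ) • 1 + v i‖ ≤ 1) (hav : Tendsto (fun i => ‖a * v i‖) l (𝓝 0))
    {K : ℝ} (hK : 0 ≤ K) (hK3 : 3 < K ^ 2 ^ m) :
    ∀ᶠ i in l, ‖(c : ℂ) • 1 + a + v i‖ < K := by
  have hcc : ‖(c : ℂ) • (1 : E)‖ ≤ 1 := (norm_ofReal_smul_one_le hone hc).trans hc1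
  have hcs : IsSelfAdjoint ((c : ℂ) • (1 : E)) := by simp [isSelfAdjoint_iff]
  induction m generalizing c a v K with
  | zero =>
    refine Eventually.of_forall fun i => lt_of_le_of_lt ?_ (by simpa using hK3)
    have h1 : (c : ℂ) • 1 + a + v i = (((c : ℂ) • 1 + a) + ((c : ℂ) • 1 + v i)) - (c : ℂ) • 1 := by
      abel
    rw [h1]
    linarith [norm_sub_le (((c : ℂ) • 1 + a) + ((c : ℂ) • 1 + v i)) ((c : ℂ) • (1 : E)),
      norm_add_le ((c : ℂ) • 1 + a) ((c : ℂ) • 1 + v i), hcv i]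
  | succ m ih =>
    have hKp : 0 < K := hK.lt_of_ne fun h => by
      rw [← h, zero_pow (by positivity)] at hK3; linarith
    obtain ⟨K', hK'3, hK'0, hK'⟩ : ∃ K', 3 < K' ^ 2 ^ m ∧ 0 < K' ∧ K' < K ^ 2 := by
      have h1 : ∀ᶠ x in 𝓝 (K ^ 2), 3 < x ^ 2 ^ m :=
        ((continuous_pow (2 ^ m)).tendsto (K ^ 2)).eventually
          (lt_mem_nhds (by rwa [← pow_mul, ← pow_succ']))
      exact ((h1.filter_mono nhdsWithin_le_nhds).and
        (Ioo_mem_nhdsLT (show 0 < K ^ 2 by positivity))).exists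
    have hsq : ∀ b : E, ((c ^ 2 : ℝ) : ℂ) • 1 + ((c : ℂ) • (2 : ℂ) • b + b * b) =
        ((c : ℂ) • 1 + b) * ((c : ℂ) • 1 + b) := fun b => by
      simp only [add_mul, mul_add, smul_mul_assoc, mul_smul_comm, one_mul, mul_one]
      push_cast
      module
    have hsa : ∀ b : E, IsSelfAdjoint b → IsSelfAdjoint ((c : ℂ) • (2 : ℂ) • b + b * b) :=
      fun b hb => by simp [isSelfAdjoint_iff, hb.star_eq]
    have hle : ∀ b : E, ‖b‖ ≤ 1 → ‖b * b‖ ≤ 1 := fun b hb =>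
      (norm_mul_le _ _).trans (mul_le_one₀ hb (norm_nonneg _) hb)
    have h2 : ∀ b : E, ‖(c : ℂ) • 1 + b‖ ≤ 1 → ‖(2 * c : ℂ) • 1 + b‖ ≤ 2 := fun b hb => by
      have : (2 * c : ℂ) • 1 + b = (c : ℂ) • 1 + ((c : ℂ) • 1 + b) := by module
      rw [this]
      linarith [norm_add_le ((c : ℂ) • (1 : E)) ((c : ℂ) • 1 + b)]
    have hc21 : c ^ 2 ≤ 1 := pow_le_one₀ hc hc1
    have key := ih (sq_nonneg c) hc21 (hsa a ha) (fun i => hsa (v i) (hv i))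
      (by rw [hsq]; exact hle _ hca) (fun i => by rw [hsq]; exact hle _ (hcv i))
      (squeeze_zero (fun _ => norm_nonneg _) (fun i => ?_) (by simpa using hav.const_mul 4))
      hK'0.le hK'3 ((norm_ofReal_smul_one_le hone (sq_nonneg c)).trans hc21)
      (by simp [isSelfAdjoint_iff])
    · filter_upwards [key, hav.eventually (gt_mem_nhds (show 0 < (K ^ 2 - K') / 2 by linarith))]
        with i hi hi'
      have hX : IsSelfAdjoint ((c : ℂ) • 1 + a + v i) := (hcs.add ha).add (hv i)
      have hva : ‖v i * a‖ = ‖a * v i‖ := by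
        rw [← norm_star, star_mul, ha.star_eq, (hv i).star_eq]
      have hX2 : ((c : ℂ) • 1 + a + v i) * ((c : ℂ) • 1 + a + v i) =
          (((c ^ 2 : ℝ) : ℂ) • 1 + ((c : ℂ) • (2 : ℂ) • a + a * a) +
            ((c : ℂ) • (2 : ℂ) • v i + v i * v i)) + (a * v i + v i * a) := by
        simp only [add_mul, mul_add, smul_mul_assoc, mul_smul_comm, one_mul, mul_one]
        push_cast
        module
      refine lt_of_pow_lt_pow_left₀ 2 hK ?_
      rw [← hX.norm_mul_self, hX2]
      refine (norm_add_le _ _).trans_lt ?_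
      linarith [norm_add_le (a * v i) (v i * a)]
    · have hprod : ((c : ℂ) • (2 : ℂ) • a + a * a) * ((c : ℂ) • (2 : ℂ) • v i + v i * v i) =
          ((2 * c : ℂ) • 1 + a) * (a * v i) * ((2 * c : ℂ) • 1 + v i) := by
        simp only [add_mul, mul_add, smul_mul_assoc, mul_smul_comm, one_mul, mul_one, mul_assoc]
        module
      rw [hprod]
      calc _ ≤ ‖(2 * c : ℂ) • 1 + a‖ * ‖a * v i‖ * ‖(2 * c : ℂ) • 1 + v i‖ :=
            norm_mul₃_le
        _ ≤ 2 * ‖a * v i‖ * 2 := by gcongr; exacts [h2 a hca, h2 _ (hcv i)]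
        _ = _ := by ring

theorem eventually_norm_add_lt (hone : ‖(1 : E)‖ ≤ 1) {c : ℝ}
    (hc : 0 ≤ c) (hc1 : c ≤ 1) {a : E} {v : ι → E} (hca : ‖(c : ℂ) • 1 + a‖ ≤ 1)
    (hcv : ∀ i, ‖(c : ℂ) • 1 + v i‖ ≤ 1)
    (h1 : Tendsto (fun i => ‖a * v i‖) l (𝓝 0)) (h2 : Tendsto (fun i => ‖a * star (v i)‖) l (𝓝 0))
    (h3 : Tendsto (fun i => ‖star a * v i‖) l (𝓝 0))
    (h4 : Tendsto (fun i => ‖star a * star (v i)‖) l (𝓝 0)) {K : ℝ} (hK : 1 < K) :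
    ∀ᶠ i in l, ‖(c : ℂ) • 1 + a + v i‖ < K := by
  obtain ⟨m, hm⟩ : ∃ m : ℕ, 3 < K ^ 2 ^ m := by
    obtain ⟨n, hn⟩ := pow_unbounded_of_one_lt 3 hK
    exact ⟨n, hn.trans_le (pow_le_pow_right₀ hK.le Nat.lt_two_pow_self.le)⟩
  have hcc : ‖(c : ℂ) • (1 : E)‖ ≤ 1 := (norm_ofReal_smul_one_le hone hc).trans hc1
  have hsq : ∀ b : E, ((c ^ 2 : ℝ) : ℂ) • 1 + ((c : ℂ) • (b + star b) + star b * b) =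
      star ((c : ℂ) • 1 + b) * ((c : ℂ) • 1 + b) := fun b => by
    simp only [star_add, star_smul, star_one, RCLike.star_def, Complex.conj_ofReal,
      add_mul, mul_add, smul_mul_assoc, mul_smul_comm, one_mul, mul_one]
    push_cast
    module
  have hsa : ∀ b : E, IsSelfAdjoint ((c : ℂ) • (b + star b) + star b * b) :=
    fun b => by simp [isSelfAdjoint_iff, add_comm]
  have hle : ∀ b : E, ‖b‖ ≤ 1 → ‖star b * b‖ ≤ 1 := fun b hb => by
    rw [CStarRing.norm_star_mul_self]; exact mul_le_one₀ hb (norm_nonneg _) hb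
  have hlim := ((h1.add h2).add h3).add h4
  simp only [add_zero] at hlim
  have key := eventually_norm_add_lt_of_isSelfAdjoint hone m (sq_nonneg c) (pow_le_one₀ hc hc1)
    (hsa a) (fun i => hsa (v i)) (by rw [hsq]; exact hle _ hca)
    (fun i => by rw [hsq]; exact hle _ (hcv i))
    (squeeze_zero (fun _ => norm_nonneg _) (fun i => ?_) hlim) (by positivity) hm
  · filter_upwards [key, h3.eventually (gt_mem_nhds (show 0 < (K ^ 2 - K) / 2 by nlinarith))]
      with i hi hi'
    have hva : ‖star (v i) * a‖ = ‖star a * v i‖ := by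
      rw [← norm_star, star_mul, star_star]
    have hX2 : star ((c : ℂ) • 1 + a + v i) * ((c : ℂ) • 1 + a + v i) =
        (((c ^ 2 : ℝ) : ℂ) • 1 + ((c : ℂ) • (a + star a) + star a * a) +
          ((c : ℂ) • (v i + star (v i)) + star (v i) * v i)) + (star a * v i + star (v i) * a) := by
      simp only [star_add, star_smul, star_one, RCLike.star_def, Complex.conj_ofReal,
        add_mul, mul_add, smul_mul_assoc, mul_smul_comm, one_mul, mul_one]
      push_cast
      module
    refine lt_of_pow_lt_pow_left₀ 2 (by positivity) ?_
    rw [pow_two, ← CStarRing.norm_star_mul_self, hX2]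
    refine (norm_add_le _ _).trans_lt ?_
    linarith [norm_add_le (star a * v i) (star (v i) * a)]
  · have hprod : ((c : ℂ) • (a + star a) + star a * a) *
        ((c : ℂ) • (v i + star (v i)) + star (v i) * v i) =
        star ((c : ℂ) • 1 + a) * (a * v i) * ((c : ℂ) • 1) +
        star ((c : ℂ) • 1 + a) * (a * star (v i)) * ((c : ℂ) • 1 + v i) +
        ((c : ℂ) • 1) * (star a * v i) * ((c : ℂ) • 1) +
        ((c : ℂ) • 1) * (star a * star (v i)) * ((c : ℂ) • 1 + v i) := by
      simp only [star_add, star_smul, star_one, RCLike.star_def, Complex.conj_ofReal,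
        add_mul, mul_add, smul_mul_assoc, mul_smul_comm, one_mul, mul_one, mul_assoc]
      module
    have hb : ∀ {x y z : E}, ‖x‖ ≤ 1 → ‖z‖ ≤ 1 → ‖x * y * z‖ ≤ ‖y‖ := fun {x y z} hx hz =>
      calc _ ≤ ‖x‖ * ‖y‖ * ‖z‖ := norm_mul₃_le
        _ ≤ 1 * ‖y‖ * 1 := by gcongr
        _ = _ := by ring
    have hca' : ‖star ((c : ℂ) • 1 + a)‖ ≤ 1 := (norm_star _).trans_le hca
    rw [hprod]
    exact (norm_add₄_le).trans (add_le_add (add_le_add (add_le_add (hb hca' hcc) (hb hca' (hcv i)))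
      (hb hcc hcc)) (hb hcc (hcv i)))

end AlmostOrthogonal

section ApproximateUnit
variable {H : Type*} [NormedAddCommGroup H] [InnerProductSpace ℂ H]

/-- `A` contains contractions `f` with `‖1 - f‖ ≤ M` acting almost as a two-sided unit on any
given finite subset of `A`. -/
def HasApproxUnit (A : Submodule ℂ (H →L[ℂ] H)) (M : ℝ) : Prop :=
  ∀ F : Finset (H →L[ℂ] H), (∀ a ∈ F, a ∈ A) → ∀ δ > 0, ∃ f ∈ A, ‖f‖ ≤ 1 ∧ ‖1 - f‖ ≤ M ∧
    ∀ a ∈ F, ‖(1 - f) * a‖ ≤ δ ∧ ‖a * (1 - f)‖ ≤ δ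

theorem IsJCai7.hasApproxUnit {A : Submodule ℂ (H →L[ℂ] H)} {ι : Type*} {l : Filter ι}
    {e : ι → A} (he : IsJCai7 A l e) : HasApproxUnit A 2 := by
  obtain ⟨hl, he1, hea⟩ := he
  intro F hF δ hδ
  have hev : ∀ a ∈ F, ∀ᶠ i in l, ‖(1 - (e i : H →L[ℂ] H)) * a‖ ≤ δ ∧
      ‖a * (1 - (e i : H →L[ℂ] H))‖ ≤ δ := by
    intro a ha
    have h1 : Tendsto (fun i => (2 - (e i : H →L[ℂ] H)) * a - a * e i) l (𝓝 0) := by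
      have := ((hea ⟨a, hF a ha⟩).const_sub a).const_smul (2 : ℂ)
      rw [sub_self, smul_zero] at this
      refine this.congr fun i => ?_
      rw [← one_add_one_eq_two (R := H →L[ℂ] H)]
      simp only [sub_mul, add_mul, one_mul]
      module
    have h2 : Tendsto (fun i => (1 - (e i : H →L[ℂ] H)) * a) l (𝓝 0) :=
      tendsto_one_sub_mul_of_jordan (e := fun i => (e i : H →L[ℂ] H)) he1 h1
    have h3 : Tendsto (fun i => a * (1 - (e i : H →L[ℂ] H))) l (𝓝 0) := by
      have := h1.sub h2
      rw [sub_zero] at this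
      refine this.congr fun i => ?_
      rw [← one_add_one_eq_two (R := H →L[ℂ] H)]
      noncomm_ring
    filter_upwards [h2.norm.eventually (gt_mem_nhds (by simpa using hδ)),
      h3.norm.eventually (gt_mem_nhds (by simpa using hδ))] with i hi hi'
    exact ⟨hi.le, hi'.le⟩
  obtain ⟨i, hi⟩ := ((eventually_all_finset F).2 hev).exists
  refine ⟨e i, (e i).2, he1 i, ?_, hi⟩
  have hone : ‖(1 : H →L[ℂ] H)‖ ≤ 1 := ContinuousLinearMap.norm_id_le
  have : ‖(e i : H →L[ℂ] H)‖ ≤ 1 := he1 i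
  linarith [norm_sub_le 1 (e i : H →L[ℂ] H)]

variable [CompleteSpace H] {A : Submodule ℂ (H →L[ℂ] H)}

theorem HasApproxUnit.improve {s : ℝ} (hs : 0 < s) (h : HasApproxUnit A (1 + s)) :
    HasApproxUnit A (1 + 4 / 5 * s) := by
  classical
  intro F hF δ hδ
  obtain ⟨f₁, hf₁A, hf₁, hu₁, hF₁⟩ := h F hF δ hδ
  obtain ⟨f₂, hf₂A, hf₂, hu₂, hF₂⟩ := h (insert f₁ F) (by simpa [hf₁A] using hF)
    (min δ ((s / 20) ^ 2 / 2)) (by positivity)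
  have h21 : ‖star (1 - f₂) * f₁‖ ≤ s / 20 := by
    have h1 := norm_star_one_sub_mul_sq_le hf₂ f₁
    have h2 := (hF₂ f₁ (Finset.mem_insert_self _ _)).1.trans (min_le_right _ _)
    refine (abs_le_of_sq_le_sq' ?_ (by positivity)).2
    nlinarith [mul_le_mul h2 hf₁ (norm_nonneg _) (by positivity)]
  have havg : 1 - (1 / 2 : ℂ) • (f₁ + f₂) = (1 / 2 : ℂ) • ((1 - f₁) + (1 - f₂)) := by module
  have hhalf : ∀ x : H →L[ℂ] H, ‖(1 / 2 : ℂ) • x‖ = ‖x‖ / 2 := fun x => by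
    rw [norm_smul]; norm_num; ring
  refine ⟨(1 / 2 : ℂ) • (f₁ + f₂), A.smul_mem _ (A.add_mem hf₁A hf₂A), ?_, ?_, fun a ha => ?_⟩
  · rw [hhalf]
    linarith [norm_add_le f₁ f₂]
  · rw [havg, hhalf]
    have hcross : ‖star (1 - f₂) * (1 - f₁)‖ ≤ 1 + s + s / 20 := by
      rw [mul_sub, mul_one]
      have := norm_sub_le (star (1 - f₂)) (star (1 - f₂) * f₁)
      rw [norm_star] at this
      linarith
    have hcross' : ‖star (1 - f₁) * (1 - f₂)‖ ≤ 1 + s + s / 20 := by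
      rwa [← norm_star, star_mul, star_star]
    have hsq : ‖(1 - f₁) + (1 - f₂)‖ ^ 2 ≤ (2 * (1 + 4 / 5 * s)) ^ 2 := by
      have hexp : star ((1 - f₁) + (1 - f₂)) * ((1 - f₁) + (1 - f₂)) =
          star (1 - f₁) * (1 - f₁) + star (1 - f₁) * (1 - f₂) + star (1 - f₂) * (1 - f₁) +
            star (1 - f₂) * (1 - f₂) := by
        rw [star_add, add_mul, mul_add, mul_add, ← add_assoc]
      rw [pow_two, ← CStarRing.norm_star_mul_self, hexp]
      refine norm_add₄_le.trans ?_
      rw [CStarRing.norm_star_mul_self, CStarRing.norm_star_mul_self]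
      nlinarith [mul_le_mul hu₁ hu₁ (norm_nonneg _) (by positivity),
        mul_le_mul hu₂ hu₂ (norm_nonneg _) (by positivity)]
    linarith [(abs_le_of_sq_le_sq' hsq (by positivity)).2]
  · obtain ⟨h1, h1'⟩ := hF₁ a ha
    obtain ⟨h2, h2'⟩ := hF₂ a (Finset.mem_insert_of_mem ha)
    have hmin := min_le_left δ ((s / 20) ^ 2 / 2)
    rw [havg, smul_mul_assoc, mul_smul_comm, hhalf, hhalf, add_mul, mul_add]
    constructor
    · linarith [norm_add_le ((1 - f₁) * a) ((1 - f₂) * a)]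
    · linarith [norm_add_le (a * (1 - f₁)) (a * (1 - f₂))]

theorem HasApproxUnit.one_add (h : HasApproxUnit A 2) {η : ℝ} (hη : 0 < η) :
    HasApproxUnit A (1 + η) := by
  have hpow : ∀ k : ℕ, HasApproxUnit A (1 + (4 / 5) ^ k) := by
    intro k
    induction k with
    | zero => simpa [one_add_one_eq_two] using h
    | succ k ih =>
      rw [pow_succ']
      exact ih.improve (by positivity)
  obtain ⟨k, hk⟩ := exists_pow_lt_of_lt_one hη (show (4 / 5 : ℝ) < 1 by norm_num)
  intro F hF δ hδ
  obtain ⟨f, hfA, hf, hu, hfF⟩ := hpow k F hF δ hδ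
  exact ⟨f, hfA, hf, hu.trans (by linarith), hfF⟩

theorem HasApproxUnit.exists_norm_add_le (h : HasApproxUnit A 2) {c : ℝ} (hc : 0 ≤ c) (hc1 : c ≤ 1)
    {F : Finset (H →L[ℂ] H)} (hFA : ∀ a ∈ F, a ∈ A) (hF : ∀ a ∈ F, ‖(c : ℂ) • 1 + a‖ ≤ 1)
    {η : ℝ} (hη : 0 < η) :
    ∃ f ∈ A, ‖f‖ ≤ 1 ∧ ∀ a ∈ F, ‖(c : ℂ) • 1 + a + ((1 - c : ℝ) : ℂ) • (1 - f)‖ ≤ 1 + η := by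
  have hone : ‖(1 : H →L[ℂ] H)‖ ≤ 1 := ContinuousLinearMap.norm_id_le
  have hη2 : 0 < 1 + η / 2 := by linarith
  choose f hfA hf hu hfF using fun n : ℕ =>
    h.one_add (half_pos hη) F hFA (1 / ((n : ℝ) + 1)) Nat.one_div_pos_of_nat
  set t : ℝ := (1 - c) / (1 + η / 2) with ht
  have ht0 : 0 ≤ t := div_nonneg (by linarith) hη2.le
  have htc : t * (1 + η / 2) = 1 - c := div_mul_cancel₀ _ hη2.ne'
  have hnorm : ∀ (r : ℝ) (x : H →L[ℂ] H), 0 ≤ r → ‖(r : ℂ) • x‖ = r * ‖x‖ := fun r x hr => by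
    rw [norm_smul, Complex.norm_of_nonneg hr]
  have hev : ∀ a ∈ F, ∀ᶠ n in atTop,
      ‖(c : ℂ) • 1 + a + (t : ℂ) • (1 - f n)‖ < 1 + η / 2 := by
    intro a ha
    have hl : Tendsto (fun n => ‖(1 - f n) * a‖) atTop (𝓝 0) :=
      squeeze_zero (fun _ => norm_nonneg _) (fun n => (hfF n a ha).1)
        tendsto_one_div_add_atTop_nhds_zero_nat
    have hr : Tendsto (fun n => ‖a * (1 - f n)‖) atTop (𝓝 0) :=
      squeeze_zero (fun _ => norm_nonneg _) (fun n => (hfF n a ha).2)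
        tendsto_one_div_add_atTop_nhds_zero_nat
    have hsqrt : ∀ {p q : ℕ → ℝ}, (∀ n, p n ^ 2 ≤ 2 * q n * ‖a‖) → Tendsto q atTop (𝓝 0) →
        (∀ n, 0 ≤ p n) → Tendsto p atTop (𝓝 0) := by
      intro p q hpq hq hp
      refine squeeze_zero hp (fun n => Real.le_sqrt_of_sq_le (hpq n)) ?_
      simpa using ((hq.const_mul 2).mul_const ‖a‖).sqrt
    have hsl : Tendsto (fun n => ‖star a * (1 - f n)‖) atTop (𝓝 0) := by
      refine (hsqrt (fun n => norm_star_one_sub_mul_sq_le (hf n) a) hl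
        fun _ => norm_nonneg _).congr fun n => ?_
      rw [← norm_star, star_mul, star_star]
    have hsr := hsqrt (fun n => norm_mul_star_one_sub_sq_le (hf n) a) hr fun _ => norm_nonneg _
    have hss : Tendsto (fun n => ‖star a * star (1 - f n)‖) atTop (𝓝 0) :=
      hl.congr fun n => by rw [← norm_star, star_mul]
    have hscale : ∀ {x : H →L[ℂ] H} {y : ℕ → H →L[ℂ] H},
        Tendsto (fun n => ‖x * y n‖) atTop (𝓝 0) →
        Tendsto (fun n => ‖x * (t : ℂ) • y n‖) atTop (𝓝 0) := fun hxy => by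
      simpa only [mul_smul_comm, hnorm t _ ht0, mul_zero] using hxy.const_mul t
    have hst : ∀ n, star ((t : ℂ) • (1 - f n)) = (t : ℂ) • star (1 - f n) := fun n => by simp
    refine eventually_norm_add_lt hone hc hc1 (hF a ha) (fun n => ?_) (hscale hr)
      (by simpa only [hst] using hscale hsr) (hscale hsl)
      (by simpa only [hst] using hscale hss) (by linarith)
    refine (norm_add_le _ _).trans ?_
    rw [hnorm t _ ht0]
    linarith [norm_ofReal_smul_one_le hone hc, mul_le_mul_of_nonneg_left (hu n) ht0]
  obtain ⟨n, hn⟩ := ((eventually_all_finset F).2 hev).exists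
  refine ⟨f n, hfA n, hf n, fun a ha => ?_⟩
  have hsplit : (c : ℂ) • 1 + a + ((1 - c : ℝ) : ℂ) • (1 - f n) =
      ((c : ℂ) • 1 + a + (t : ℂ) • (1 - f n)) + ((t * (η / 2) : ℝ) : ℂ) • (1 - f n) := by
    rw [← htc]
    push_cast
    module
  rw [hsplit]
  refine (norm_add_le _ _).trans ?_
  rw [hnorm _ _ (by positivity)]
  have h1 : t * (η / 2) * ‖1 - f n‖ ≤ t * (η / 2) * (1 + η / 2) :=
    mul_le_mul_of_nonneg_left (hu n) (by positivity)
  have h2 : t * (η / 2) * (1 + η / 2) = (1 - c) * (η / 2) := by rw [← htc]; ring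
  nlinarith [hn a ha]

theorem HasApproxUnit.exists_halve_excess (h : HasApproxUnit A 2) {z : H →L[ℂ] H} {ε : ℝ}
    (hz : z ∈ A) (hzε : ‖1 - z‖ ≤ 1 + ε) (hε : 0 < ε) (hε1 : ε ≤ 1) :
    ∃ z' ∈ A, ‖1 - z'‖ ≤ 1 + ε / 2 ∧ ‖z - z'‖ ≤ 4 * ε := by
  have hone : ‖(1 : H →L[ℂ] H)‖ ≤ 1 := ContinuousLinearMap.norm_id_le
  have hnorm : ∀ (r : ℝ) (x : H →L[ℂ] H), 0 ≤ r → ‖(r : ℂ) • x‖ = r * ‖x‖ := fun r x hr => by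
    rw [norm_smul, Complex.norm_of_nonneg hr]
  have hzn : ‖z‖ ≤ 3 := by
    have := norm_sub_le 1 (1 - z)
    rw [sub_sub_cancel] at this
    linarith
  obtain ⟨f, hfA, hf, hfz⟩ := h.exists_norm_add_le (c := 1 - ε) (by linarith) (by linarith)
    (F := {-((1 - ε : ℝ) : ℂ) • z}) (by simpa using A.smul_mem (-((1 - ε : ℝ) : ℂ)) hz) (by
      have : ((1 - ε : ℝ) : ℂ) • 1 + -((1 - ε : ℝ) : ℂ) • z = ((1 - ε : ℝ) : ℂ) • (1 - z) := by
        module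
      simp only [Finset.mem_singleton, forall_eq]
      rw [this, hnorm _ _ (by linarith)]
      nlinarith) (half_pos hε)
  refine ⟨((1 - ε : ℝ) : ℂ) • z + (ε : ℂ) • f, A.add_mem (A.smul_mem _ hz) (A.smul_mem _ hfA),
    ?_, ?_⟩
  · refine le_of_eq_of_le ?_ (hfz _ (Finset.mem_singleton_self _))
    congr 1
    push_cast
    module
  · have : z - (((1 - ε : ℝ) : ℂ) • z + (ε : ℂ) • f) = (ε : ℂ) • (z - f) := by
      push_cast
      module
    rw [this, hnorm _ _ hε.le]
    nlinarith [norm_sub_le z f]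

theorem HasApproxUnit.exists_norm_one_sub_le_one (h : HasApproxUnit A 2)
    (hA : IsClosed (A : Set (H →L[ℂ] H))) {z : H →L[ℂ] H} {ε : ℝ}
    (hz : z ∈ A) (hzε : ‖1 - z‖ ≤ 1 + ε) (hε : 0 < ε) (hε1 : ε ≤ 1) :
    ∃ z' ∈ A, ‖1 - z'‖ ≤ 1 ∧ ‖z - z'‖ ≤ 8 * ε := by
  choose! g hgA hg1 hgd using fun (w : H →L[ℂ] H) (δ : ℝ) (hw : w ∈ A) (hwδ : ‖1 - w‖ ≤ 1 + δ)
    (hδ : 0 < δ) (hδ1 : δ ≤ 1) => h.exists_halve_excess hw hwδ hδ hδ1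
  let s : ℕ → H →L[ℂ] H := fun n => n.rec z fun n w => g w (ε / 2 ^ n)
  have hδ : ∀ n : ℕ, 0 < ε / 2 ^ n := fun n => by positivity
  have hδ1 : ∀ n : ℕ, ε / 2 ^ n ≤ 1 := fun n =>
    (div_le_self hε.le (one_le_pow₀ one_le_two)).trans hε1
  have hs : ∀ n, s n ∈ A ∧ ‖1 - s n‖ ≤ 1 + ε / 2 ^ n := by
    intro n
    induction n with
    | zero => exact ⟨hz, by simpa [s] using hzε⟩
    | succ n ih =>
      refine ⟨hgA _ _ ih.1 ih.2 (hδ n) (hδ1 n), ?_⟩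
      rw [pow_succ, ← div_div]
      exact hg1 _ _ ih.1 ih.2 (hδ n) (hδ1 n)
  have hd : ∀ n, dist (s n) (s (n + 1)) ≤ 8 * ε / 2 / 2 ^ n := fun n => by
    rw [dist_eq_norm]
    refine (hgd _ _ (hs n).1 (hs n).2 (hδ n) (hδ1 n)).trans_eq ?_
    ring
  obtain ⟨w, hw⟩ := cauchySeq_tendsto_of_complete (cauchySeq_of_le_geometric_two hd)
  refine ⟨w, hA.mem_of_tendsto hw (Eventually.of_forall fun n => (hs n).1), ?_, ?_⟩
  · refine le_of_tendsto_of_tendsto' (hw.const_sub 1).norm ?_ fun n => (hs n).2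
    have := (tendsto_pow_atTop_nhds_zero_of_lt_one (r := (1 / 2 : ℝ)) (by norm_num)
      (by norm_num)).const_mul ε |>.const_add 1
    simpa [div_eq_mul_inv] using this
  · rw [← dist_eq_norm]
    exact dist_le_of_le_geometric_two_of_tendsto₀ hd hw

/-- The unit ball of `A` is approximated by differences of elements `z` with `‖1 - 2 z‖ ≤ 1`. -/
theorem HasApproxUnit.exists_approx_sub (h : HasApproxUnit A 2)
    (hA : IsClosed (A : Set (H →L[ℂ] H))) {x : H →L[ℂ] H} (hx : x ∈ A) (hx1 : ‖x‖ ≤ 1)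
    {ε : ℝ} (hε : 0 < ε) (hε1 : ε ≤ 1) :
    ∃ a ∈ A, ∃ b ∈ A, ‖a‖ ≤ 1 ∧ ‖b‖ ≤ 1 ∧ (a + star a).IsPositive ∧ (b + star b).IsPositive ∧
      ‖x - (a - b)‖ ≤ 8 * ε := by
  classical
  have hone : ‖(1 : H →L[ℂ] H)‖ ≤ 1 := ContinuousLinearMap.norm_id_le
  have hhalf : ∀ x : H →L[ℂ] H, ‖(1 / 2 : ℂ) • x‖ = ‖x‖ / 2 := fun x => by
    rw [norm_smul]; norm_num; ring
  have hball : ∀ z : H →L[ℂ] H, ‖1 - z‖ ≤ 1 → ‖(1 / 2 : ℂ) • z‖ ≤ 1 ∧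
      ((1 / 2 : ℂ) • z + star ((1 / 2 : ℂ) • z)).IsPositive := by
    intro z hz
    constructor
    · rw [hhalf]
      have := norm_sub_le 1 (1 - z)
      rw [sub_sub_cancel] at this
      linarith
    · apply isPositive_add_star_of_norm_one_sub_le
      have : 1 - (1 / 2 : ℂ) • z = (1 / 2 : ℂ) • (1 + (1 - z)) := by module
      rw [this, hhalf]
      linarith [norm_add_le 1 (1 - z)]
  obtain ⟨f, hfA, -, hf⟩ := h.exists_norm_add_le le_rfl zero_le_one (F := {x, -x})
    (by simp [hx]) (by simp [hx1]) hε
  have hf' : ‖1 - (f + x)‖ ≤ 1 + ε ∧ ‖1 - (f - x)‖ ≤ 1 + ε := by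
    refine ⟨le_of_eq_of_le ?_ (hf (-x) (by simp)), le_of_eq_of_le ?_ (hf x (by simp))⟩ <;>
    · congr 1
      push_cast
      module
  obtain ⟨z, hzA, hz, hzd⟩ := h.exists_norm_one_sub_le_one hA (A.add_mem hfA hx) hf'.1 hε hε1
  obtain ⟨w, hwA, hw, hwd⟩ := h.exists_norm_one_sub_le_one hA (A.sub_mem hfA hx) hf'.2 hε hε1
  refine ⟨_, A.smul_mem (1 / 2) hzA, _, A.smul_mem (1 / 2) hwA, (hball z hz).1, (hball w hw).1,
    (hball z hz).2, (hball w hw).2, ?_⟩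
  have : x - ((1 / 2 : ℂ) • z - (1 / 2 : ℂ) • w) =
      (1 / 2 : ℂ) • ((f + x - z) - (f - x - w)) := by module
  rw [this, hhalf]
  linarith [norm_sub_le (f + x - z) (f - x - w)]

end ApproximateUnit

/-- If `f ⪯ g ⪯ h` in `B(A, ℝ)` for the ordering induced by the real positive
cone of an approximately unital Jordan operator algebra, then `‖g‖ ≤ ‖f‖ + ‖h‖`. -/
theorem stmt7 {H : Type*} [NormedAddCommGroup H] [InnerProductSpace ℂ H] [CompleteSpace H]
    (A : Submodule ℂ (H →L[ℂ] H)) (hA : IsClosed (A : Set (H →L[ℂ] H)))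
    (hsq : ∀ a ∈ A, a * a ∈ A)
    (hcai : ∃ (ι : Type) (l : Filter ι) (e : ι → ↥A), IsJCai7 A l e)
    (f g h : ↥A →L[ℝ] ℝ)
    (hfg : ∀ x : ↥A, ((x : H →L[ℂ] H) + star (x : H →L[ℂ] H)).IsPositive → f x ≤ g x)
    (hgh : ∀ x : ↥A, ((x : H →L[ℂ] H) + star (x : H →L[ℂ] H)).IsPositive → g x ≤ h x) :
    ‖g‖ ≤ ‖f‖ + ‖h‖ := by
  obtain ⟨ι, l, e, he⟩ := hcai
  refine g.opNorm_le_of_unit_norm (by positivity) fun x hx => ?_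
  have hupper : ∀ x : A, ‖x‖ ≤ 1 → g x ≤ ‖f‖ + ‖h‖ := by
    intro x hx
    refine le_of_forall_pos_le_add fun δ hδ => ?_
    obtain ⟨ε, hε, hε1, hεδ⟩ : ∃ ε : ℝ, 0 < ε ∧ ε ≤ 1 ∧ ‖g‖ * (8 * ε) ≤ δ := by
      have hg : 0 < 8 * (‖g‖ + 1) := by positivity
      refine ⟨min 1 (δ / (8 * (‖g‖ + 1))), by positivity, min_le_left _ _, ?_⟩
      have h1 := (le_div_iff₀ hg).1 (min_le_right 1 (δ / (8 * (‖g‖ + 1))))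
      have h2 : 0 ≤ min 1 (δ / (8 * (‖g‖ + 1))) := by positivity
      linarith
    obtain ⟨a, haA, b, hbA, ha, hb, hapos, hbpos, hab⟩ :=
      he.hasApproxUnit.exists_approx_sub hA x.2 hx hε hε1
    have h1 : g x = g ⟨a, haA⟩ - g ⟨b, hbA⟩ + g (x - (⟨a, haA⟩ - ⟨b, hbA⟩)) := by
      simp only [map_sub]
      ring
    have h2 : g (x - (⟨a, haA⟩ - ⟨b, hbA⟩)) ≤ ‖g‖ * (8 * ε) :=
      (le_abs_self _).trans (g.le_opNorm_of_le hab)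
    have h3 : h ⟨a, haA⟩ ≤ ‖h‖ * 1 := (le_abs_self _).trans (h.le_opNorm_of_le ha)
    have h4 : -f ⟨b, hbA⟩ ≤ ‖f‖ * 1 := (neg_le_abs _).trans (f.le_opNorm_of_le hb)
    linarith [hgh ⟨a, haA⟩ hapos, hfg ⟨b, hbA⟩ hbpos]
  rw [Real.norm_eq_abs]
  refine abs_le.2 ⟨?_, hupper x hx.le⟩
  have := hupper (-x) (by rw [norm_neg]; exact hx.le)
  rw [map_neg] at this
  linarith
end

section
/- Let J be an approximately unital closed Jordan ideal in a Jordan operator algebra A (not necessarily approximately unital), and q : A → A/J the quotient map. Then the image of the real positive cone is the real positive cone of the quotient: q(𝔯_A) = 𝔯_{A/J}. -/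
set_option synthInstance.maxHeartbeats 1000000
set_option maxHeartbeats 1000000

/-- A Jordan contractive approximate identity. -/
def IsJCai8 {H : Type*} [NormedAddCommGroup H] [InnerProductSpace ℂ H]
    (J : Submodule ℂ (H →L[ℂ] H)) {ι : Type*} (l : Filter ι) (e : ι → ↥J) : Prop :=
  l.NeBot ∧ (∀ i, ‖e i‖ ≤ 1) ∧
    ∀ a : ↥J, Filter.Tendsto
      (fun i => ((1 : ℂ) / 2) • ((e i : H →L[ℂ] H) * a + (a : H →L[ℂ] H) * (e i : H →L[ℂ] H)))
      l (nhds (a : H →L[ℂ] H))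

section AccretiveLifting

open Filter Topology
open scoped ComplexOrder Pointwise

/-- Convergence in the weak operator topology along an ultrafilter. -/
def TendstoWeakly {K : Type*} [NormedAddCommGroup K] [InnerProductSpace ℂ K] {ι : Type*}
    (U : Ultrafilter ι) (T : ι → K →L[ℂ] K) (P : K →L[ℂ] K) : Prop :=
  ∀ x y, Tendsto (fun i => inner ℂ (T i x) y) U (𝓝 (inner ℂ (P x) y))

namespace TendstoWeakly

variable {K : Type*} [NormedAddCommGroup K] [InnerProductSpace ℂ K] {ι : Type*}
  {U : Ultrafilter ι} {T T' : ι → K →L[ℂ] K} {P P' : K →L[ℂ] K}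

theorem add (h : TendstoWeakly U T P) (h' : TendstoWeakly U T' P') :
    TendstoWeakly U (fun i => T i + T' i) (P + P') := fun x y => by
  simpa [inner_add_left] using (h x y).add (h' x y)

theorem mul_right (h : TendstoWeakly U T P) (S : K →L[ℂ] K) :
    TendstoWeakly U (fun i => T i * S) (P * S) := fun x y => h (S x) y

theorem mul_left [CompleteSpace K] (h : TendstoWeakly U T P) (S : K →L[ℂ] K) :
    TendstoWeakly U (fun i => S * T i) (S * P) := fun x y => by
  simpa [ContinuousLinearMap.adjoint_inner_right] using h x (ContinuousLinearMap.adjoint S y)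

theorem of_tendsto (h : Tendsto T U (𝓝 P)) : TendstoWeakly U T P := fun x y => by
  have h1 : Continuous fun S : K →L[ℂ] K => inner ℂ (S x) y := by fun_prop
  exact (h1.tendsto _).comp h

theorem unique (h : TendstoWeakly U T P) (h' : TendstoWeakly U T P') : P = P' :=
  ContinuousLinearMap.ext fun x => ext_inner_right ℂ fun y =>
    tendsto_nhds_unique (h x y) (h' x y)

end TendstoWeakly

/-- A net of contractions on a Hilbert space converges weakly along any ultrafilter. -/
theorem exists_weak_limit_of_contractions {K : Type*} [NormedAddCommGroup K]
    [InnerProductSpace ℂ K] [CompleteSpace K] {ι : Type*} (U : Ultrafilter ι)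
    (T : ι → K →L[ℂ] K) (hT : ∀ i, ‖T i‖ ≤ 1) :
    ∃ P : K →L[ℂ] K, ‖P‖ ≤ 1 ∧ TendstoWeakly U T P := by
  have hb : ∀ x y i, ‖inner ℂ (T i x) y‖ ≤ ‖x‖ * ‖y‖ := fun x y i => by
    refine (norm_inner_le_norm _ _).trans ?_
    gcongr
    exact (T i).le_of_opNorm_le (hT i) x |>.trans (by simp)
  have hlim : ∀ x y, ∃ c : ℂ, Tendsto (fun i => inner ℂ (T i x) y) U (𝓝 c) := fun x y => by
    have hc : IsCompact (Metric.closedBall (0 : ℂ) (‖x‖ * ‖y‖)) := isCompact_closedBall _ _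
    obtain ⟨c, -, h⟩ := hc.ultrafilter_le_nhds (U.map fun i => inner ℂ (T i x) y) (by
      rw [le_principal_iff]
      exact mem_map.2 (Eventually.of_forall fun i => by simpa using hb x y i))
    exact ⟨c, h⟩
  choose c hc using hlim
  have hcb : ∀ x y, ‖c x y‖ ≤ ‖x‖ * ‖y‖ := fun x y =>
    le_of_tendsto (hc x y).norm (Eventually.of_forall (hb x y))
  let L : K →ₗ⋆[ℂ] K →ₗ[ℂ] ℂ := LinearMap.mk₂'ₛₗ (starRingEnd ℂ) (RingHom.id ℂ) c
    (fun x x' y => tendsto_nhds_unique (hc _ _)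
      (by simpa [inner_add_left] using (hc x y).add (hc x' y)))
    (fun a x y => tendsto_nhds_unique (hc _ _)
      (by simpa [inner_smul_left, mul_comm] using (hc x y).const_mul (starRingEnd ℂ a)))
    (fun x y y' => tendsto_nhds_unique (hc _ _)
      (by simpa [inner_add_right] using (hc x y).add (hc x y')))
    (fun a x y => tendsto_nhds_unique (hc _ _)
      (by simpa [inner_smul_right] using (hc x y).const_mul a))
  let B : K →L⋆[ℂ] K →L[ℂ] ℂ := L.mkContinuous₂ 1 fun x y => by simpa [L] using hcb x y
  have hP : ∀ x y, inner ℂ (InnerProductSpace.continuousLinearMapOfBilin B x) y = c x y :=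
    fun x y => InnerProductSpace.continuousLinearMapOfBilin_apply B x y
  refine ⟨InnerProductSpace.continuousLinearMapOfBilin B, ?_, fun x y => (hP x y).symm ▸ hc x y⟩
  refine ContinuousLinearMap.opNorm_le_bound _ zero_le_one fun x => ?_
  rw [one_mul]
  set z := InnerProductSpace.continuousLinearMapOfBilin B x with hz
  by_cases h0 : ‖z‖ = 0
  · rw [h0]; positivity
  have h1 : ‖z‖ * ‖z‖ ≤ ‖x‖ * ‖z‖ := by
    have h2 := hcb x z
    rw [← hP, ← hz, inner_self_eq_norm_sq_to_K] at h2
    simpa [← pow_two] using h2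
  exact le_of_mul_le_mul_right h1 (lt_of_le_of_ne (norm_nonneg _) (Ne.symm h0))

/-- A contractive idempotent on a Hilbert space has range orthogonal to its kernel. -/
theorem inner_eq_zero_of_contractive_idempotent {K : Type*} [NormedAddCommGroup K]
    [InnerProductSpace ℂ K] {P : K →L[ℂ] K} (hP : ‖P‖ ≤ 1) {u v : K} (hu : P u = u)
    (hv : P v = 0) : inner ℂ u v = 0 := by
  set c := inner ℂ u v with hc
  set s : ℝ := 1 / (‖v‖ ^ 2 + 1) with hs
  have hle : ‖u‖ ≤ ‖u + (-((s : ℂ) * starRingEnd ℂ c)) • v‖ := by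
    have := P.le_of_opNorm_le hP (u + (-((s : ℂ) * starRingEnd ℂ c)) • v)
    simpa [hu, hv] using this
  have hsq := pow_le_pow_left₀ (norm_nonneg _) hle 2
  rw [norm_add_sq (𝕜 := ℂ), inner_smul_right, ← hc, norm_smul, mul_pow] at hsq
  have hre : RCLike.re (-((s : ℂ) * starRingEnd ℂ c) * c) = -(s * ‖c‖ ^ 2) := by
    rw [neg_mul, mul_assoc, mul_comm (starRingEnd ℂ c), Complex.mul_conj']
    norm_cast
  have hspos : 0 < s := by positivity
  have hs1 : s * ‖v‖ ^ 2 ≤ 1 := by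
    rw [hs, one_div, inv_mul_le_iff₀ (by positivity)]; linarith
  rw [hre, norm_neg, norm_mul, RCLike.norm_conj, Complex.norm_real, Real.norm_eq_abs,
    abs_of_pos hspos] at hsq
  have hz : s * ‖c‖ ^ 2 ≤ 0 := by
    have : (s * ‖c‖) ^ 2 * ‖v‖ ^ 2 = (s * ‖c‖ ^ 2) * (s * ‖v‖ ^ 2) := by ring
    nlinarith [mul_le_mul_of_nonneg_left hs1 (by positivity : 0 ≤ s * ‖c‖ ^ 2)]
  have : ‖c‖ ^ 2 ≤ 0 := by
    by_contra! h
    exact absurd hz (not_le.mpr (mul_pos hspos h))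
  exact norm_eq_zero.mp (by nlinarith [norm_nonneg c])

/-- In any representation, the support projection of an approximately unital Jordan ideal
commutes with the algebra and acts as the identity on the ideal. -/
theorem exists_central_support {B K : Type*} [CStarAlgebra B] [NormedAddCommGroup K]
    [InnerProductSpace ℂ K] [CompleteSpace K] (A J : Submodule ℂ B)
    (hJA : J ≤ A) (hideal : ∀ η ∈ J, ∀ ξ ∈ A, η * ξ + ξ * η ∈ J)
    {ι : Type*} (U : Ultrafilter ι) (e : ι → B)
    (heJ : ∀ i, e i ∈ J) (he : ∀ i, ‖e i‖ ≤ 1)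
    (hlim : ∀ a ∈ J, Tendsto (fun i => e i * a + a * e i) U (𝓝 (a + a)))
    (π : B →⋆ₐ[ℂ] (K →L[ℂ] K)) :
    ∃ P : K →L[ℂ] K, ‖P‖ ≤ 1 ∧ P * P = P ∧ (∀ a ∈ A, P * π a = π a * P) ∧
      (∀ a ∈ J, π a * P = π a) ∧ TendstoWeakly U (fun i => π (e i)) P := by
  have hbound : ∀ a, ‖π a‖ ≤ ‖a‖ := fun a => NonUnitalStarAlgHom.norm_apply_le π a
  have hπ : Continuous π :=
    AddMonoidHomClass.continuous_of_bound π 1 fun a => by simpa using hbound a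
  obtain ⟨P, hP1, hP⟩ := exists_weak_limit_of_contractions U (fun i => π (e i))
    fun i => (hbound _).trans (he i)
  have hL : ∀ S, TendstoWeakly U (fun i => π (e i) * S + S * π (e i)) (P * S + S * P) :=
    fun S => (hP.mul_right S).add (hP.mul_left S)
  have hJ2 : ∀ a ∈ J, P * π a + π a * P = π a + π a := fun a ha => by
    refine (hL (π a)).unique (.of_tendsto ?_)
    simpa [Function.comp_def] using (hπ.tendsto _).comp (hlim a ha)
  have cancel : ∀ S T : K →L[ℂ] K, S + S = T + T → S = T := fun S T h => by
    rw [← two_smul ℂ S, ← two_smul ℂ T] at h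
    exact smul_right_injective _ (two_ne_zero' ℂ) h
  have hidem : P * P = P := by
    refine cancel _ _ ((hL P).unique ?_)
    have h2 : ∀ i, π (e i) * P + P * π (e i) = π (e i) + π (e i) := fun i => by
      rw [add_comm]; exact hJ2 _ (heJ i)
    simp_rw [h2]
    exact hP.add hP
  have hcomm : ∀ a ∈ A, P * π a = π a * P := fun a ha => by
    set S := π a with hS
    have h : P * (P * S + S * P) + (P * S + S * P) * P = (P * S + S * P) + (P * S + S * P) := by
      have h2 : ∀ i, P * (π (e i) * S + S * π (e i)) + (π (e i) * S + S * π (e i)) * P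
          = (π (e i) * S + S * π (e i)) + (π (e i) * S + S * π (e i)) := fun i => by
        have := hJ2 _ (hideal _ (heJ i) a ha)
        simpa only [map_add, map_mul] using this
      refine TendstoWeakly.unique (((hL S).mul_left P).add ((hL S).mul_right P)) ?_
      simp_rw [h2]
      exact (hL S).add (hL S)
    have h3 : P * S * P + P * S * P = P * S + S * P := by
      have e1 : P * (P * S + S * P) + (P * S + S * P) * P
          = (P * P) * S + P * S * P + (P * S * P + S * (P * P)) := by noncomm_ring
      rw [e1, hidem] at h
      have e2 : P * S * P + P * S * P - (P * S + S * P) =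
        (P * S + P * S * P + (P * S * P + S * P)) - (P * S + S * P + (P * S + S * P)) := by
        abel
      rw [h, sub_self] at e2
      exact sub_eq_zero.mp e2
    have h4 : P * S * P = P * S := by
      have := congrArg (P * ·) h3
      simp only [mul_add, ← mul_assoc, hidem] at this
      exact add_right_cancel this
    rw [h4] at h3
    exact add_left_cancel h3
  refine ⟨P, hP1, hidem, hcomm, fun a ha => ?_, hP⟩
  have h := hJ2 a ha
  rw [hcomm a (hJA ha)] at h
  exact cancel _ _ h

/-- A contractive idempotent on a Hilbert space reduces every operator commuting with it. -/
theorem inner_apply_self_of_commute_idempotent {K : Type*} [NormedAddCommGroup K]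
    [InnerProductSpace ℂ K] {P T : K →L[ℂ] K} (hP : ‖P‖ ≤ 1) (hidem : P * P = P)
    (hcomm : P * T = T * P) (x : K) :
    inner ℂ (T x) x = inner ℂ (T (P x)) (P x) + inner ℂ (T (x - P x)) (x - P x) := by
  have hPP : ∀ v, P (P v) = P v := fun v => DFunLike.congr_fun hidem v
  have hPT : ∀ v, P (T v) = T (P v) := fun v => DFunLike.congr_fun hcomm v
  have h1 : inner ℂ (T (P x)) (x - P x) = 0 :=
    inner_eq_zero_of_contractive_idempotent hP (by rw [hPT, hPP]) (by simp [hPP])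
  have h2 : inner ℂ (T (x - P x)) (P x) = 0 :=
    inner_eq_zero_symm.mp <|
      inner_eq_zero_of_contractive_idempotent hP (hPP x) (by rw [hPT]; simp [hPP])
  calc inner ℂ (T x) x = inner ℂ (T (P x) + T (x - P x)) (P x + (x - P x)) := by
        rw [← map_add, add_sub_cancel]
    _ = _ := by rw [inner_add_left, inner_add_right, inner_add_right, h1, h2]; ring

theorem neg_mul_norm_sq_le_re_inner {K : Type*} [NormedAddCommGroup K]
    [InnerProductSpace ℂ K] [CompleteSpace K] {T : K →L[ℂ] K} {c : ℝ}
    (h : 0 ≤ T + star T + c • (1 : K →L[ℂ] K)) (x : K) :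
    -(c * ‖x‖ ^ 2) ≤ 2 * (inner ℂ (T x) x).re := by
  have h1 := ((ContinuousLinearMap.nonneg_iff_isPositive _).mp h).re_inner_nonneg_left x
  have h2 : (inner ℂ (star T x) x).re = (inner ℂ (T x) x).re := by
    rw [ContinuousLinearMap.star_eq_adjoint, ContinuousLinearMap.adjoint_inner_left]
    exact inner_re_symm (𝕜 := ℂ) x (T x)
  have h3 : (inner ℂ (c • x) x).re = c * ‖x‖ ^ 2 := by
    rw [← Complex.coe_smul, inner_smul_left, inner_self_eq_norm_sq_to_K]
    simp [← Complex.ofReal_pow]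
  simp only [add_apply, smul_apply, one_apply_eq_self, inner_add_left, h2, h3, map_add,
    RCLike.re_eq_complex_re] at h1
  linarith

section CStar

variable {B : Type*} [CStarAlgebra B] [PartialOrder B] [StarOrderedRing B]

theorem self_add_star_le_of_norm_le {a : B} {c : ℝ} (h : ‖a‖ ≤ c) :
    a + star a ≤ (2 * c) • (1 : B) := by
  have hsa : IsSelfAdjoint (a + star a) := IsSelfAdjoint.add_star_self a
  refine hsa.le_algebraMap_norm_self.trans ?_
  rw [Algebra.algebraMap_eq_smul_one]
  have : ‖a + star a‖ ≤ 2 * c := (norm_add_le _ _).trans (by rw [norm_star]; linarith)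
  exact smul_le_smul_of_nonneg_right this zero_le_one

/-- A continuous real functional that is nonnegative on accretive elements is the real part of a
vector functional in some representation. -/
theorem exists_representation_of_nonneg_on_accretive (g : StrongDual ℝ B)
    (hg : ∀ b : B, 0 ≤ b + star b → 0 ≤ g b) :
    ∃ ω : B →ₚ[ℂ] ℂ, ∃ ξ : ω.GNS, ∀ a, (inner ℂ (ω.gnsStarAlgHom a ξ) ξ).re = g a := by
  have hpos : ∀ x : B, 0 ≤ x → 0 ≤ Module.Dual.extendRCLike (𝕜 := ℂ) (g : Module.Dual ℝ B) x :=
      fun x hx => by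
    have hs : star x = x := (IsSelfAdjoint.of_nonneg hx).star_eq
    have h1 : g (Complex.I • x) = 0 := by
      apply le_antisymm
      · have := hg (-(Complex.I • x)) (by simp [hs])
        simpa using this
      · exact hg _ (by simp [hs])
    rw [Complex.le_def]
    constructor
    · have h2 := Module.Dual.re_extendRCLike_apply (𝕜 := ℂ) (g : Module.Dual ℝ B) x
      rw [RCLike.re_eq_complex_re] at h2
      rw [h2]
      exact hg x (by rw [hs]; exact add_nonneg hx hx)
    · simp [Module.Dual.extendRCLike_apply, h1]
  let ω : B →ₚ[ℂ] ℂ := PositiveLinearMap.mk₀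
    (Module.Dual.extendRCLike (𝕜 := ℂ) (g : Module.Dual ℝ B)) hpos
  refine ⟨ω, ((ω.toPreGNS 1 : ω.PreGNS) : ω.GNS), fun a => ?_⟩
  have h : inner ℂ ((ω.toPreGNS 1 : ω.PreGNS) : ω.GNS)
      (ω.gnsStarAlgHom a ((ω.toPreGNS 1 : ω.PreGNS) : ω.GNS)) = ω a := by
    simp [PositiveLinearMap.preGNS_inner_def]
  rw [← inner_conj_symm, h, Complex.conj_re]
  exact Module.Dual.re_extendRCLike_apply (𝕜 := ℂ) (g : Module.Dual ℝ B) a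

/-- If `z` is almost accretive, and congruent modulo the ideal to some `w` which is closer to
being accretive, then a small correction of `z` by an element of the ideal is about as close to
being accretive as `w`. -/
theorem exists_small_correction (A J : Submodule ℂ B) (hJA : J ≤ A)
    (hideal : ∀ η ∈ J, ∀ ξ ∈ A, η * ξ + ξ * η ∈ J) {ι : Type*} (U : Ultrafilter ι) (e : ι → B)
    (heJ : ∀ i, e i ∈ J) (he : ∀ i, ‖e i‖ ≤ 1)
    (hlim : ∀ a ∈ J, Tendsto (fun i => e i * a + a * e i) U (𝓝 (a + a)))
    {z w : B} (hz : z ∈ A) (hzw : z - w ∈ J) {ε δ δ' : ℝ} (hε : 0 ≤ ε) (hδ : 0 ≤ δ)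
    (hδ' : δ < δ') (hzε : 0 ≤ z + star z + (2 * ε) • (1 : B))
    (hwδ : 0 ≤ w + star w + δ • (1 : B)) :
    ∃ k ∈ J, ‖k‖ ≤ ε ∧ 0 ≤ (z + k) + star (z + k) + δ' • (1 : B) := by
  set C : Set B := {b | 0 ≤ b + star b} with hC
  have hCconv : Convex ℝ C := fun a ha b hb s t hs ht _ => by
    have : s • a + t • b + star (s • a + t • b) = s • (a + star a) + t • (b + star b) := by
      simp only [star_add, star_smul, star_trivial, smul_add]; abel
    rw [hC, Set.mem_ofPred_eq, this]
    exact add_nonneg (smul_nonneg hs ha) (smul_nonneg ht hb)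
  set D : Set B := Metric.ball 0 (δ' / 2)
  set L : Set B := (fun k => z + k) '' {k | k ∈ J ∧ ‖k‖ ≤ ε}
  have hLconv : Convex ℝ L := by
    refine Convex.translate (s := {k | k ∈ J ∧ ‖k‖ ≤ ε}) ?_ z
    have : {k : B | k ∈ J ∧ ‖k‖ ≤ ε} = (J.restrictScalars ℝ : Set B) ∩ Metric.closedBall 0 ε := by
      ext; simp
    rw [this]
    exact (Submodule.convex _).inter (convex_closedBall _ _)
  by_cases hdisj : Disjoint (C + D) L
  · exfalso
    obtain ⟨f, u, hf, hu⟩ := geometric_hahn_banach_open (hCconv.add (convex_ball _ _))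
      (Metric.isOpen_ball.add_left) hLconv hdisj
    have hone : (-(δ / 2)) • (1 : B) ∈ D := by
      cases subsingleton_or_nontrivial B
      · simpa [D, Subsingleton.elim _ (0 : B)] using by linarith
      · simp [D, norm_smul, abs_of_nonneg hδ]; linarith
    have hneg : ∀ b ∈ C, 0 ≤ (-f) b := fun b hb => by
      by_contra! hcon
      have hfb : 0 < f b := by simpa using hcon
      obtain ⟨n, hn⟩ := exists_nat_gt (u / f b)
      have h1 := hf ((n : ℝ) • b + 0) (Set.add_mem_add
        (by
          have : (n : ℝ) • b + star ((n : ℝ) • b) = (n : ℝ) • (b + star b) := by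
            simp [smul_add]
          rw [hC, Set.mem_ofPred_eq, this]
          exact smul_nonneg n.cast_nonneg hb)
        (by simpa [D] using by linarith))
      rw [add_zero, map_smul, smul_eq_mul] at h1
      rw [div_lt_iff₀ hfb] at hn
      linarith
    obtain ⟨ω, ξ, hω⟩ := exists_representation_of_nonneg_on_accretive (-f) hneg
    obtain ⟨P, hP1, hidem, hcomm, hPJ, hPlim⟩ :=
      exists_central_support A J hJA hideal U e heJ he hlim ω.gnsStarAlgHom
    set π := ω.gnsStarAlgHom
    have hPP : ∀ v, P (P v) = P v := fun v => DFunLike.congr_fun hidem v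
    have hu1 : δ / 2 * ‖ξ‖ ^ 2 < u := by
      have h1 := hf (0 + (-(δ / 2)) • (1 : B)) (Set.add_mem_add (by simp [hC]) hone)
      have h2 := hω 1
      rw [map_one, one_apply_eq_self, inner_self_eq_norm_sq_to_K] at h2
      simp [← Complex.ofReal_pow] at h1 h2
      rw [h2]; linarith
    have hlimle : (inner ℂ (π z ξ) ξ).re + ε * (inner ℂ (P ξ) ξ).re ≤ -u := by
      have ht := ((Complex.continuous_re.tendsto _).comp (hPlim ξ ξ)).const_mul ε
      refine le_of_tendsto (ht.const_add (inner ℂ (π z ξ) ξ).re) (Eventually.of_forall fun i => ?_)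
      have h1 := hu (z + (ε : ℂ) • e i) ⟨_, ⟨J.smul_mem _ (heJ i), by
        rw [norm_smul, Complex.norm_real, Real.norm_eq_abs, abs_of_nonneg hε]
        exact mul_le_of_le_one_right hε (he i)⟩, rfl⟩
      rw [Complex.coe_smul, map_add, map_smul, smul_eq_mul] at h1
      have h2 := hω z
      have h3 := hω (e i)
      simp only [Function.comp_apply, neg_apply] at h2 h3 ⊢
      rw [h2, h3]; linarith
    have hmap : ∀ {a : B} {c : ℝ}, 0 ≤ a + star a + c • (1 : B) →
        0 ≤ π a + star (π a) + c • (1 : ω.GNS →L[ℂ] ω.GNS) := fun {a c} h => by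
      have h1 := map_nonneg π h
      rw [← Complex.coe_smul] at h1 ⊢
      simpa only [map_add, map_star, map_smul, map_one] using h1
    have hzq : π z (ξ - P ξ) = π w (ξ - P ξ) := by
      have hq : π (z - w) (ξ - P ξ) = 0 := by
        rw [← hPJ _ hzw, mul_apply_eq_comp, map_sub P, hPP, sub_self, map_zero]
      rw [map_sub π, sub_apply] at hq
      exact sub_eq_zero.mp hq
    have horth : inner ℂ (P ξ) (ξ - P ξ) = 0 :=
      inner_eq_zero_of_contractive_idempotent hP1 (hPP ξ) (by simp [hPP])
    have hpξ : (inner ℂ (P ξ) ξ).re = ‖P ξ‖ ^ 2 := by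
      rw [inner_sub_right, sub_eq_zero] at horth
      rw [horth, inner_self_eq_norm_sq_to_K]
      simp [← Complex.ofReal_pow]
    have hnorm : ‖ξ‖ ^ 2 = ‖P ξ‖ ^ 2 + ‖ξ - P ξ‖ ^ 2 := by
      have := norm_add_sq (𝕜 := ℂ) (P ξ) (ξ - P ξ)
      rw [horth, add_sub_cancel] at this
      simpa using this
    have hsplit := congrArg Complex.re
      (inner_apply_self_of_commute_idempotent hP1 hidem (hcomm z hz) ξ)
    rw [hzq, Complex.add_re] at hsplit
    have i1 := neg_mul_norm_sq_le_re_inner (hmap hzε) (P ξ)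
    have i2 := neg_mul_norm_sq_le_re_inner (hmap hwδ) (ξ - P ξ)
    nlinarith [mul_nonneg hδ (sq_nonneg ‖P ξ‖)]
  · obtain ⟨_, ⟨b, hb, d, hd, rfl⟩, k, ⟨hkJ, hk⟩, hzk⟩ := Set.not_disjoint_iff.mp hdisj
    refine ⟨k, hkJ, hk, ?_⟩
    have hd' : ‖-d‖ ≤ δ' / 2 := by
      rw [norm_neg]
      exact (mem_ball_zero_iff.mp hd).le
    have h1 := sub_nonneg.mpr (self_add_star_le_of_norm_le hd')
    have h2 : (z + k) + star (z + k) + δ' • (1 : B)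
        = (b + star b) + ((2 * (δ' / 2)) • (1 : B) - (-d + star (-d))) := by
      have : z + k = b + d := hzk
      rw [this, mul_div_cancel₀ _ two_ne_zero]
      simp only [star_add, star_neg]; abel
    rw [h2]
    exact add_nonneg hb h1

/-- An element which is accretive modulo the ideal lifts to an accretive element. -/
theorem exists_accretive_lift (A J : Submodule ℂ B) (hJ : IsClosed (J : Set B)) (hJA : J ≤ A)
    (hideal : ∀ η ∈ J, ∀ ξ ∈ A, η * ξ + ξ * η ∈ J) {ι : Type*} (U : Ultrafilter ι) (e : ι → B)
    (heJ : ∀ i, e i ∈ J) (he : ∀ i, ‖e i‖ ≤ 1)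
    (hlim : ∀ a ∈ J, Tendsto (fun i => e i * a + a * e i) U (𝓝 (a + a)))
    {x : B} (hx : x ∈ A)
    (happrox : ∀ ε > (0 : ℝ), ∃ w, x - w ∈ J ∧ 0 ≤ w + star w + ε • (1 : B)) :
    ∃ r, x - r ∈ J ∧ 0 ≤ r + star r := by
  let Q : ℕ → B → Prop := fun n z => x - z ∈ J ∧ 0 ≤ z + star z + (2 * (1 / 2 : ℝ) ^ n) • (1 : B)
  have step : ∀ n (z : {z // Q n z}), ∃ z' : {z // Q (n + 1) z},
      dist z.1 z'.1 ≤ 1 * (1 / 2 : ℝ) ^ n := by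
    rintro n ⟨z, hzJ, hz⟩
    have hpos : (0 : ℝ) < (1 / 2) ^ n := by positivity
    obtain ⟨w, hwJ, hw⟩ := happrox ((1 / 2) ^ n / 2) (by positivity)
    have hzA : z ∈ A := by simpa using A.sub_mem hx (hJA hzJ)
    have hzw : z - w ∈ J := by simpa using J.sub_mem hwJ hzJ
    obtain ⟨k, hkJ, hk, hzk⟩ := exists_small_correction A J hJA hideal U e heJ he hlim hzA hzw
      hpos.le (by positivity) (by rw [pow_succ]; linarith : _ < 2 * (1 / 2 : ℝ) ^ (n + 1)) hz hw
    refine ⟨⟨z + k, by simpa [sub_sub] using J.sub_mem hzJ hkJ, hzk⟩, by simpa using hk⟩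
  choose next hnext using step
  obtain ⟨w, hw⟩ := happrox 2 two_pos
  let s : ∀ n, {z // Q n z} := fun n =>
    Nat.rec (motive := fun n => {z // Q n z}) ⟨w, by simpa [Q] using hw⟩ (fun n z => next n z) n
  obtain ⟨r, hr⟩ := cauchySeq_tendsto_of_complete (cauchySeq_of_le_geometric (1 / 2) 1
    (by norm_num) (fun n => hnext n (s n)) : CauchySeq fun n => (s n).1)
  refine ⟨r, hJ.mem_of_tendsto (hr.const_sub x) (Eventually.of_forall fun n => (s n).2.1), ?_⟩
  have hc : Tendsto (fun n : ℕ => (2 * (1 / 2 : ℝ) ^ n) • (1 : B)) atTop (𝓝 0) := by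
    have := (tendsto_pow_atTop_nhds_zero_of_lt_one (by norm_num : (0 : ℝ) ≤ 1 / 2)
      (by norm_num)).const_mul 2
    simpa using this.smul_const (1 : B)
  have hlim' := (hr.add hr.star).add hc
  rw [add_zero] at hlim'
  exact ge_of_tendsto' hlim' fun n => (s n).2.2

/-- A multiple of an element which is within distance one of the identity modulo `J` is congruent
to an almost accretive element, and so are its small perturbations. -/
theorem exists_almost_accretive_of_infDist (J : Submodule ℂ B) {x y : B} {t ε : ℝ} (ht : 0 ≤ t)
    (hy : Metric.infDist (1 - y) (J : Set B) ≤ 1)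
    (hxy : Metric.infDist (x - t • y) (J : Set B) < ε) :
    ∃ w, x - w ∈ J ∧ 0 ≤ w + star w + (4 * ε) • (1 : B) := by
  have hne : (J : Set B).Nonempty := ⟨0, J.zero_mem⟩
  have hε : 0 < ε := Metric.infDist_nonneg.trans_lt hxy
  obtain ⟨j₁, hj₁, h₁⟩ := (Metric.infDist_lt_iff hne).mp
    (hy.trans_lt (lt_add_of_pos_right 1 (by positivity : 0 < ε / (t + 1))))
  obtain ⟨j₂, hj₂, h₂⟩ := (Metric.infDist_lt_iff hne).mp hxy
  rw [dist_eq_norm] at h₁ h₂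
  have hJt : ((t : ℂ) • j₁) ∈ J := J.smul_mem _ hj₁
  rw [Complex.coe_smul] at hJt
  refine ⟨x - j₂ + t • j₁, by simpa [sub_add_eq_sub_sub] using J.sub_mem hj₂ hJt, ?_⟩
  have i₁ := smul_nonneg ht (sub_nonneg.mpr (self_add_star_le_of_norm_le h₁.le))
  have i₂ := sub_nonneg.mpr (self_add_star_le_of_norm_le ((norm_neg _).trans_le h₂.le))
  have hc : t * (2 * (1 + ε / (t + 1))) - t * 2 ≤ 2 * ε := by
    have : t * (ε / (t + 1)) ≤ ε := by
      rw [mul_div_assoc', div_le_iff₀ (by positivity)]; nlinarith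
    linarith
  have i₃ : 0 ≤ (2 * ε - (t * (2 * (1 + ε / (t + 1))) - t * 2)) • (1 : B) :=
    smul_nonneg (sub_nonneg.mpr hc) zero_le_one
  refine (add_nonneg (add_nonneg i₁ i₂) i₃).trans_eq ?_
  simp only [star_add, star_sub, star_neg, star_smul, star_trivial, star_one]
  module

/-- The Cayley transform of an accretive element is a contraction. -/
theorem norm_cayley_le_one {s g : B} (hs : 0 ≤ s + star s) (hg : (1 + s) * g = 1) :
    ‖(1 - s) * g‖ ≤ 1 := by
  have h1 : star (1 - s) * (1 - s) ≤ star (1 + s) * (1 + s) := by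
    rw [← sub_nonneg]
    have : star (1 + s) * (1 + s) - star (1 - s) * (1 - s) = (s + star s) + (s + star s) := by
      simp only [star_add, star_sub, star_one]; noncomm_ring
    rw [this]
    exact add_nonneg hs hs
  have h2 := star_left_conjugate_le_conjugate h1 g
  have h3 : star g * (star (1 + s) * (1 + s)) * g = 1 := by
    rw [mul_assoc, mul_assoc, hg, mul_one, ← star_mul, hg, star_one]
  have h4 : star g * (star (1 - s) * (1 - s)) * g = star ((1 - s) * g) * ((1 - s) * g) := by
    simp only [star_mul, mul_assoc]
  rw [h3, h4, ← CStarAlgebra.norm_le_one_iff_of_nonneg _ (star_mul_self_nonneg _),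
    CStarRing.norm_star_mul_self] at h2
  nlinarith [norm_nonneg ((1 - s) * g)]

end CStar

/-- A subspace closed under squares is closed under nonzero powers. -/
theorem pow_succ_mem_of_sq_mem {R : Type*} [Ring R] [Algebra ℂ R] (A : Submodule ℂ R)
    (hsq : ∀ a ∈ A, a * a ∈ A) {r : R} (hr : r ∈ A) (n : ℕ) : r ^ (n + 1) ∈ A := by
  induction n with
  | zero => simpa using hr
  | succ n ih =>
    have h1 := A.sub_mem (A.sub_mem (hsq _ (A.add_mem ih hr)) (hsq _ ih)) (hsq _ hr)
    have h2 : (r ^ (n + 1) + r) * (r ^ (n + 1) + r) - r ^ (n + 1) * r ^ (n + 1) - r * r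
        = (2 : ℂ) • r ^ (n + 1 + 1) := by
      rw [two_smul, pow_succ r (n + 1)]
      simp only [add_mul, mul_add, ← pow_succ, ← pow_succ']
      abel
    rw [h2] at h1
    simpa using A.smul_mem (2⁻¹ : ℂ) h1

/-- Accretive elements of a closed Jordan algebra are limits of nonnegative multiples of elements
within distance one of the identity. -/
theorem exists_norm_one_sub_le_one_of_accretive {B : Type*} [CStarAlgebra B] [PartialOrder B]
    [StarOrderedRing B] (A : Submodule ℂ B) (hA : IsClosed (A : Set B))
    (hsq : ∀ a ∈ A, a * a ∈ A) {r : B} (hr : r ∈ A) (hacc : 0 ≤ r + star r) {ε : ℝ}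
    (hε : 0 < ε) :
    ∃ t : ℝ, 0 ≤ t ∧ ∃ y ∈ A, ‖1 - y‖ ≤ 1 ∧ ‖r - t • y‖ < ε := by
  obtain ⟨d, hd, hd1, hd2⟩ : ∃ d : ℝ, 0 < d ∧ d * ‖r‖ ≤ 1 / 2 ∧ 2 * d * ‖r‖ ^ 2 < ε := by
    refine ⟨min (1 / (2 * (‖r‖ + 1))) (ε / (4 * (‖r‖ ^ 2 + 1))), by positivity, ?_, ?_⟩
    · refine (mul_le_mul_of_nonneg_right (min_le_left _ _) (norm_nonneg r)).trans ?_
      rw [one_div_mul_eq_div, div_le_iff₀ (by positivity)]; linarith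
    · refine (mul_le_mul_of_nonneg_right (mul_le_mul_of_nonneg_left (min_le_right _ _) two_pos.le)
        (sq_nonneg ‖r‖)).trans_lt ?_
      rw [mul_div_assoc', div_mul_eq_mul_div, div_lt_iff₀ (by positivity)]
      nlinarith [sq_nonneg ‖r‖, mul_nonneg hε.le (sq_nonneg ‖r‖)]
  set s := d • r with hs
  have hsn : ‖s‖ ≤ 1 / 2 := by rwa [hs, norm_smul, Real.norm_eq_abs, abs_of_pos hd]
  have hsA : s ∈ A := by
    have := A.smul_mem (d : ℂ) hr
    rwa [Complex.coe_smul] at this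
  have hsacc : 0 ≤ s + star s := by
    have := smul_nonneg hd.le hacc
    rwa [smul_add, ← star_trivial d, ← star_smul, star_trivial] at this
  have hlt : ‖-s‖ < 1 := by rw [norm_neg]; linarith
  have hsum : Summable fun n : ℕ => (-s) ^ n := summable_geometric_of_norm_lt_one hlt
  set g := ∑' n : ℕ, (-s) ^ n with hg
  have hg1 : (1 + s) * g = 1 := by simpa [hg] using mul_neg_geom_series (-s) hlt
  have hsg : s * g ∈ A := by
    have h1 : HasSum (fun n : ℕ => s * (-s) ^ n) (s * g) := hsum.hasSum.mul_left s
    refine hA.mem_of_tendsto h1 (Eventually.of_forall fun F => A.sum_mem fun n _ => ?_)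
    have h2 := A.neg_mem (pow_succ_mem_of_sq_mem A hsq (A.neg_mem hsA) n)
    rwa [pow_succ', neg_mul, neg_neg] at h2
  have hsub : 1 - s * g = g := by rw [← hg1]; noncomm_ring
  refine ⟨1 / (2 * d), by positivity, (2 : ℂ) • (s * g), A.smul_mem _ hsg, ?_, ?_⟩
  · have h1 : 1 - (2 : ℂ) • (s * g) = (1 - s) * g := by
      rw [two_smul, sub_add_eq_sub_sub, hsub, sub_mul, one_mul]
    rw [h1]
    exact norm_cayley_le_one hsacc hg1
  · have h1 : (1 / (2 * d)) • ((2 : ℂ) • (s * g)) = r * g := by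
      rw [two_smul, ← two_smul ℝ, smul_smul, hs, smul_mul_assoc, smul_smul]
      have : 1 / (2 * d) * 2 * d = 1 := by field_simp
      rw [this, one_smul]
    have h2 : r - r * g = r * (s * g) := by
      rw [← mul_one_sub, ← hsub, sub_sub_cancel, hsub]
    have hgn : ‖g‖ ≤ 2 := by
      have h3 : ‖g‖ ≤ ‖(1 : B)‖ + 1 / 2 * ‖g‖ := by
        calc ‖g‖ = ‖1 - s * g‖ := by rw [hsub]
          _ ≤ ‖(1 : B)‖ + ‖s * g‖ := norm_sub_le _ _
          _ ≤ _ := by gcongr; exact (norm_mul_le _ _).trans (by gcongr)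
      have h4 : ‖(1 : B)‖ ≤ 1 := by
        cases subsingleton_or_nontrivial B
        · simp [Subsingleton.elim (1 : B) 0]
        · simp
      linarith
    rw [h1, h2]
    refine lt_of_le_of_lt ?_ hd2
    calc ‖r * (s * g)‖ ≤ ‖r‖ * (‖s‖ * ‖g‖) :=
          (norm_mul_le _ _).trans (by gcongr; exact norm_mul_le _ _)
      _ ≤ ‖r‖ * ((d * ‖r‖) * 2) := by
          gcongr
          rw [hs, norm_smul, Real.norm_eq_abs, abs_of_pos hd]
      _ = _ := by ring

end AccretiveLifting

/-- If `J` is an approximately unital closed Jordan ideal in a Jordan operator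
algebra `A`, then the image under the quotient map of the real positive cone of
`A` is the real positive cone of `A/J`.  Here subsets of `A/J` are encoded as
`J`-saturated subsets of `A`; the quotient norm of `A¹/J` is the distance to `J`;
`𝔉_{A/J} = {x̄ : ‖1 − x̄‖ ≤ 1}` and `𝔯_{A/J}` is the closure (in the quotient) of
`ℝ₊ · 𝔉_{A/J}`. -/
theorem stmt8 {H : Type*} [NormedAddCommGroup H] [InnerProductSpace ℂ H] [CompleteSpace H]
    (A J : Submodule ℂ (H →L[ℂ] H))
    (hA : IsClosed (A : Set (H →L[ℂ] H))) (hsq : ∀ a ∈ A, a * a ∈ A)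
    (hJ : IsClosed (J : Set (H →L[ℂ] H))) (hJA : J ≤ A)
    (hideal : ∀ η ∈ J, ∀ ξ ∈ A, η * ξ + ξ * η ∈ J)
    (hJcai : ∃ (ι : Type) (l : Filter ι) (e : ι → ↥J), IsJCai8 J l e) :
    -- the image `q(𝔯_A)`, as a `J`-saturated subset of `A`:
    {x : H →L[ℂ] H | x ∈ A ∧ ∃ r ∈ A,
        ((r + star r) : H →L[ℂ] H).IsPositive ∧ x - r ∈ J}
    = -- the cone `𝔯_{A/J} = closure(ℝ₊ 𝔉_{A/J})`, as a `J`-saturated subset of `A`: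
    {x : H →L[ℂ] H | x ∈ A ∧ ∀ ε > (0 : ℝ), ∃ t : ℝ, 0 ≤ t ∧ ∃ y ∈ A,
        Metric.infDist (1 - y) (J : Set (H →L[ℂ] H)) ≤ 1 ∧
        Metric.infDist (x - t • y) (J : Set (H →L[ℂ] H)) < ε} := by
  obtain ⟨ι, l, e, hl, he, hlim⟩ := hJcai
  ext x
  constructor
  · rintro ⟨hx, r, hr, hacc, hxr⟩
    refine ⟨hx, fun ε hε => ?_⟩
    obtain ⟨t, ht, y, hy, h1, h2⟩ := exists_norm_one_sub_le_one_of_accretive A hA hsq hr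
      ((ContinuousLinearMap.nonneg_iff_isPositive _).mpr hacc) hε
    refine ⟨t, ht, y, hy, ?_, ?_⟩
    · refine (Metric.infDist_le_dist_of_mem J.zero_mem).trans ?_
      simpa using h1
    · refine (Metric.infDist_le_dist_of_mem hxr).trans_lt ?_
      rwa [dist_eq_norm, sub_sub_sub_cancel_left]
  · rintro ⟨hx, happ⟩
    obtain ⟨r, hxr, hr⟩ := exists_accretive_lift A J hJ hJA hideal (Ultrafilter.of l)
      (fun i => (e i : H →L[ℂ] H)) (fun i => (e i).2) he
      (fun a ha => by
        have h1 := ((hlim ⟨a, ha⟩).const_smul (2 : ℂ)).mono_left (Ultrafilter.of_le l)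
        simpa [smul_smul, two_smul] using h1)
      hx
      (fun ε hε => by
        obtain ⟨t, ht, y, -, h1, h2⟩ := happ (ε / 4) (by positivity)
        have := exists_almost_accretive_of_infDist J ht h1 h2
        rwa [mul_div_cancel₀ _ four_ne_zero] at this)
    refine ⟨hx, r, ?_, (ContinuousLinearMap.nonneg_iff_isPositive _).mp hr, hxr⟩
    simpa using A.sub_mem hx (hJA hxr)
end

section
/- Let A be a Jordan operator algebra and x ∈ A real positive. If there exists y ∈ A with xyx = x, then 0 is either absent from or an isolated point of the spectrum Sp_A(x). -/
set_option synthInstance.maxHeartbeats 1000000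
set_option maxHeartbeats 1000000

open scoped InnerProductSpace

/-- A nonzero scalar `l` is not in the spectrum of an element `x` with a group inverse `v`
as soon as `1 - l • v` is invertible. -/
theorem isUnit_smul_one_sub_of_group_inverse {𝕜 R : Type*} [Field 𝕜] [Ring R] [Algebra 𝕜 R]
    {x v p : R} (hxp : x * p = x) (hpx : p * x = x) (hpv : p * v = v) (hvp : v * p = v)
    (hxv : x * v = p) (hvx : v * x = p) {l : 𝕜} (hl : l ≠ 0) (hu : IsUnit (1 - l • v)) :
    IsUnit (l • 1 - x) := by
  have hpp : p * p = p := by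
    nth_rw 1 [← hxv]
    rw [mul_assoc, hvp, hxv]
  have h1 : l • 1 - x = (l • (1 - p) - x) * (1 - l • v) := by
    simp only [mul_sub, sub_mul, mul_one, one_mul, smul_mul_assoc, mul_smul_comm, smul_sub,
      hpv, hxv]
    abel
  have h2 : IsUnit (l • (1 - p) - x) := by
    refine ⟨⟨l • (1 - p) - x, l⁻¹ • (1 - p) - v, ?_, ?_⟩, rfl⟩ <;>
    · simp only [mul_sub, sub_mul, mul_one, one_mul, smul_mul_assoc, mul_smul_comm, smul_sub,
        hpv, hvp, hxp, hpx, hxv, hvx, hpp, smul_smul, inv_mul_cancel₀ hl, mul_inv_cancel₀ hl,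
        one_smul]
      abel
  rw [h1]
  exact h2.mul hu

section HilbertSpace

variable {H : Type*} [NormedAddCommGroup H] [InnerProductSpace ℂ H] [CompleteSpace H]

theorem ContinuousLinearMap.IsPositive.apply_eq_zero_of_inner_eq_zero {T : H →L[ℂ] H}
    (hT : T.IsPositive) {ξ : H} (h : ⟪T ξ, ξ⟫_ℂ = 0) : T ξ = 0 := by
  obtain ⟨s, rfl⟩ := CStarAlgebra.nonneg_iff_eq_star_mul_self.mp
    ((ContinuousLinearMap.nonneg_iff_isPositive T).mpr hT)
  have hs : s ξ = 0 := by
    rw [← inner_self_eq_zero (𝕜 := ℂ)]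
    rwa [mul_apply_eq_comp, ContinuousLinearMap.star_eq_adjoint,
      ContinuousLinearMap.adjoint_inner_left] at h
  simp [hs]

/-- The kernel of a real positive operator is contained in that of its adjoint. -/
theorem star_apply_eq_zero_of_isPositive_add_star {x : H →L[ℂ] H}
    (hpos : (x + star x).IsPositive) {ξ : H} (h : x ξ = 0) : star x ξ = 0 := by
  have := hpos.apply_eq_zero_of_inner_eq_zero (ξ := ξ) (by
    simp [h, ContinuousLinearMap.star_eq_adjoint,
      ContinuousLinearMap.adjoint_inner_left])
  simpa [h] using this

/-- A real positive operator `x` with a generalized inverse `y` has a group inverse. -/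
theorem exists_group_inverse_of_isPositive_add_star {x y : H →L[ℂ] H}
    (hpos : (x + star x).IsPositive) (hxyx : x * y * x = x) :
    ∃ v p : H →L[ℂ] H, x * p = x ∧ p * x = x ∧ p * v = v ∧ v * p = v ∧ x * v = p ∧ v * x = p := by
  have hpos' : (star x + star (star x)).IsPositive := by rwa [star_star, add_comm]
  have hcomplete : CompleteSpace x.ker := x.isClosed_ker.completeSpace_coe
  set q : H →L[ℂ] H := x.ker.starProjection with hq
  have hqq : q * q = q := x.ker.isIdempotentElem_starProjection
  have hqs : star q = q := isSelfAdjoint_starProjection x.ker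
  have hxq : x * q = 0 := by
    ext ξ
    exact x.ker.starProjection_apply_mem ξ
  have hsxq : star x * q = 0 := by
    ext ξ
    exact star_apply_eq_zero_of_isPositive_add_star hpos (x.ker.starProjection_apply_mem ξ)
  have hqx : q * x = 0 := by simpa [hqs] using congrArg star hsxq
  have hfix {z : H →L[ℂ] H} (hz : x * z = 0) : q * z = z := by
    ext ξ
    exact Submodule.starProjection_eq_self_iff.mpr (congr($hz ξ) : x (z ξ) = 0)
  have hfix' {z : H →L[ℂ] H} (hz : star x * z = 0) : q * z = z := by
    refine hfix ?_
    ext ξ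
    have := star_apply_eq_zero_of_isPositive_add_star hpos' (congr($hz ξ) : star x (z ξ) = 0)
    rwa [star_star] at this
  have hyx : (1 - q) * (y * x) = 1 - q := by
    have := hfix (z := y * x - 1) (by rw [mul_sub, ← mul_assoc, hxyx, mul_one, sub_self])
    rw [mul_sub, mul_one] at this
    rw [sub_mul, one_mul, sub_eq_sub_iff_sub_eq_sub, ← this]
  have hxy : x * y * (1 - q) = 1 - q := by
    have h : x * y * x - x = 0 := sub_eq_zero.mpr hxyx
    have := hfix' (z := star (x * y - 1)) (by
      rw [← star_mul, sub_mul, one_mul, h, star_zero])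
    have := congrArg star this
    rw [star_mul, star_star, hqs, sub_mul, one_mul] at this
    rw [mul_sub, mul_one, sub_eq_sub_iff_sub_eq_sub, ← this]
  have hpp : (1 - q) * (1 - q) = 1 - q := by
    rw [mul_sub, mul_one, sub_mul, one_mul, hqq, sub_self, sub_zero]
  have hxp : x * (1 - q) = x := by rw [mul_sub, mul_one, hxq, sub_zero]
  have hpx : (1 - q) * x = x := by rw [sub_mul, one_mul, hqx, sub_zero]
  refine ⟨(1 - q) * y * (1 - q), 1 - q, hxp, hpx, ?_, ?_, ?_, ?_⟩
  · rw [← mul_assoc, ← mul_assoc, hpp]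
  · rw [mul_assoc, hpp]
  · rw [← mul_assoc, ← mul_assoc, hxp, hxy]
  · rw [mul_assoc, hpx, mul_assoc, hyx]

/-- The open left half-plane is in the resolvent set of a real positive operator. -/
theorem isUnit_smul_one_sub_of_re_neg {x : H →L[ℂ] H} (hpos : (x + star x).IsPositive) {l : ℂ}
    (hl : l.re < 0) : IsUnit (l • 1 - x) := by
  refine ContinuousLinearMap.isUnit_of_forall_le_norm_inner_map _ (c := (-l.re).toNNReal)
    (by simpa using hl) fun ξ ↦ ?_
  have h := hpos.re_inner_nonneg_left ξ
  have hre : (⟪star x ξ, ξ⟫_ℂ).re = (⟪x ξ, ξ⟫_ℂ).re := by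
    rw [ContinuousLinearMap.star_eq_adjoint, ContinuousLinearMap.adjoint_inner_left,
      ← inner_conj_symm, Complex.conj_re]
  rw [add_apply, inner_add_left, map_add] at h
  simp only [RCLike.re_to_complex, hre] at h
  have hξ : (⟪(l • (1 : H →L[ℂ] H) - x) ξ, ξ⟫_ℂ).re = l.re * ‖ξ‖ ^ 2 - (⟪x ξ, ξ⟫_ℂ).re := by
    rw [sub_apply, smul_apply,
      one_apply_eq_self, inner_sub_left, inner_smul_left, inner_self_eq_norm_sq_to_K,
      Complex.sub_re]
    congr 1
    simp [← Complex.ofReal_pow]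
  have := neg_abs_le (⟪(l • (1 : H →L[ℂ] H) - x) ξ, ξ⟫_ℂ).re
  have := Complex.abs_re_le_norm ⟪(l • (1 : H →L[ℂ] H) - x) ξ, ξ⟫_ℂ
  rw [Real.coe_toNNReal _ (by linarith)]
  linarith

end HilbertSpace

/-- If the spectrum of `x` misses a punctured disc around `0` and the open left half-plane, then
the punctured disc is also missed by the spectrum of `x` in the closed unital algebra it
generates. -/
theorem exists_inverse_mem_elemental {B : Type*} [NormedRing B] [NormedAlgebra ℂ B]
    [CompleteSpace B] {x : B} {ε : ℝ} (hε : 0 < ε)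
    (hdisc : ∀ l : ℂ, l ≠ 0 → ‖l‖ < ε → IsUnit (l • 1 - x))
    (hleft : ∀ l : ℂ, l.re < 0 → IsUnit (l • 1 - x)) {l : ℂ} (hl : l ≠ 0) (hlε : ‖l‖ < ε) :
    ∃ w ∈ Algebra.elemental ℂ x, (l • 1 - x) * w = 1 ∧ w * (l • 1 - x) = 1 := by
  let S := Algebra.elemental ℂ x
  let x' : S := ⟨x, Algebra.elemental.self_mem ℂ x⟩
  have hS : IsClosed (S : Set B) := Algebra.elemental.isClosed ℂ x
  suffices h : l ∉ spectrum ℂ x' by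
    rw [spectrum.notMem_iff, Algebra.algebraMap_eq_smul_one] at h
    obtain ⟨u, hu⟩ := h
    have hu' : ((u : S) : B) = l • 1 - x := by rw [hu]; rfl
    refine ⟨((u⁻¹ : Sˣ) : S), ((u⁻¹ : Sˣ) : S).2, ?_, ?_⟩
    · rw [← hu']; exact congrArg Subtype.val u.mul_inv
    · rw [← hu']; exact congrArg Subtype.val u.inv_mul
  intro hmem
  let D : Set ℂ := Complex.exp '' {z | z.re < Real.log ε}
  have hD (z : ℂ) : z ∈ D ↔ z ≠ 0 ∧ ‖z‖ < ε := by
    constructor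
    · rintro ⟨w, hw, rfl⟩
      exact ⟨Complex.exp_ne_zero w, by
        rw [Complex.norm_exp]; exact (Real.lt_log_iff_exp_lt hε).mp hw⟩
    · rintro ⟨hz, hzε⟩
      refine ⟨Complex.log z, ?_, Complex.exp_log hz⟩
      rw [Set.mem_ofPred_eq, Complex.log_re]
      exact Real.log_lt_log (norm_pos_iff.mpr hz) hzε
  have hDconn : IsPreconnected D :=
    (convex_halfSpace_re_lt _).isPreconnected.image _ Complex.continuous_exp.continuousOn
  have hLconn : IsPreconnected {z : ℂ | z.re < 0} := (convex_halfSpace_re_lt 0).isPreconnected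
  have hconn : IsPreconnected (D ∪ {z : ℂ | z.re < 0}) := by
    refine IsPreconnected.union (-(ε / 2 : ℝ) : ℂ) ((hD _).mpr ⟨?_, ?_⟩) ?_ hDconn hLconn
    · exact neg_ne_zero.mpr (Complex.ofReal_ne_zero.mpr (by positivity))
    · rw [norm_neg, Complex.norm_real, Real.norm_of_nonneg (by positivity)]
      linarith
    · rw [Set.mem_ofPred_eq, Complex.neg_re, Complex.ofReal_re]
      linarith
  have hsub : D ∪ {z : ℂ | z.re < 0} ⊆ (spectrum ℂ (x' : B))ᶜ := by
    intro z hz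
    rw [Set.mem_compl_iff, spectrum.notMem_iff, Algebra.algebraMap_eq_smul_one]
    rcases hz with hz | hz
    · exact hdisc z ((hD z).mp hz).1 ((hD z).mp hz).2
    · exact hleft z hz
  have hbdd := (Subalgebra.spectrum_isBounded_connectedComponentIn S x' hmem).subset
    (hconn.subset_connectedComponentIn (Or.inl ((hD l).mpr ⟨hl, hlε⟩)) hsub)
  obtain ⟨C, hC⟩ := hbdd.exists_norm_le
  have h := hC (-(|C| + 1 : ℝ) : ℂ) (Or.inr (by
    rw [Set.mem_ofPred_eq, Complex.neg_re, Complex.ofReal_re]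
    linarith [abs_nonneg C]))
  rw [norm_neg, Complex.norm_real, Real.norm_of_nonneg (by positivity)] at h
  linarith [le_abs_self C]

/-- A subspace closed under squaring contains the positive powers of its elements. -/
theorem pow_succ_mem_of_forall_mul_self_mem {R : Type*} [Ring R] [Algebra ℂ R]
    {A : Submodule ℂ R} (hsq : ∀ a ∈ A, a * a ∈ A) {x : R} (hx : x ∈ A) (n : ℕ) :
    x ^ (n + 1) ∈ A := by
  induction n with
  | zero => simpa using hx
  | succ n ih =>
    have h : x ^ (n + 1 + 1) = ((1 : ℂ) / 2) •
        ((x + x ^ (n + 1)) * (x + x ^ (n + 1)) - x * x - x ^ (n + 1) * x ^ (n + 1)) := by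
      rw [show (x + x ^ (n + 1)) * (x + x ^ (n + 1)) - x * x - x ^ (n + 1) * x ^ (n + 1)
          = (2 : ℂ) • x ^ (n + 1 + 1) by
        rw [two_smul, add_mul, mul_add, mul_add, ← pow_succ, ← pow_succ' x (n + 1)]; abel,
        smul_smul]
      norm_num
    rw [h]
    exact A.smul_mem _ (A.sub_mem (A.sub_mem (hsq _ (A.add_mem hx ih)) (hsq _ hx)) (hsq _ ih))

/-- The closed unital algebra generated by an element of a closed Jordan subalgebra is contained
in the unitization of that subalgebra. -/
theorem mem_sup_span_one_of_mem_elemental {B : Type*} [NormedRing B] [NormedAlgebra ℂ B]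
    {A : Submodule ℂ B} (hA : IsClosed (A : Set B)) (hsq : ∀ a ∈ A, a * a ∈ A) {x : B}
    (hx : x ∈ A) {w : B} (hw : w ∈ Algebra.elemental ℂ x) : w ∈ A ⊔ (ℂ ∙ (1 : B)) := by
  have hclosed := A.isClosed_sup_finiteDimensional (ℂ ∙ (1 : B)) hA
  refine closure_minimal ?_ hclosed hw
  intro z hz
  obtain ⟨P, rfl⟩ := Algebra.adjoin_singleton_eq_range_aeval ℂ x ▸ hz
  change Polynomial.aeval x P ∈ A ⊔ (ℂ ∙ (1 : B))
  rw [Polynomial.aeval_eq_sum_range]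
  refine Submodule.sum_mem _ fun n _ ↦ Submodule.smul_mem _ _ ?_
  cases n with
  | zero => exact Submodule.mem_sup_right (by simp)
  | succ n => exact Submodule.mem_sup_left (pow_succ_mem_of_forall_mul_self_mem hsq hx n)

/-- If `x` is a real positive element of a Jordan operator algebra `A` and
`xyx = x` for some `y ∈ A`, then `0` is isolated in or absent from the spectrum
of `x` relative to the unitization `A¹ = A + ℂ1`, where `λ` is in the spectrum
iff `λ1 − x` has no Jordan inverse `w ∈ A¹` (i.e. `z ∘ w = 1` and `z² ∘ w = z`). -/
theorem stmt10 {H : Type*} [NormedAddCommGroup H] [InnerProductSpace ℂ H] [CompleteSpace H]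
    (A : Submodule ℂ (H →L[ℂ] H)) (hA : IsClosed (A : Set (H →L[ℂ] H)))
    (hsq : ∀ a ∈ A, a * a ∈ A)
    (x : H →L[ℂ] H) (hx : x ∈ A) (hpos : (x + star x).IsPositive)
    (y : H →L[ℂ] H) (hy : y ∈ A) (hxyx : x * y * x = x) :
    ∃ ε > (0 : ℝ), ∀ lam : ℂ,
      lam ∈ {l : ℂ | ¬ ∃ w ∈ A ⊔ (ℂ ∙ (1 : H →L[ℂ] H)),
          ((1 : ℂ) / 2) • ((l • 1 - x) * w + w * (l • 1 - x)) = (1 : H →L[ℂ] H) ∧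
          ((1 : ℂ) / 2) • ((l • 1 - x) * (l • 1 - x) * w + w * ((l • 1 - x) * (l • 1 - x)))
            = l • 1 - x} →
      ‖lam‖ < ε → lam = 0 := by
  obtain ⟨v, p, hxp, hpx, hpv, hvp, hxv, hvx⟩ :=
    exists_group_inverse_of_isPositive_add_star hpos hxyx
  have hv : 0 < ‖v‖ + 1 := by positivity
  refine ⟨(‖v‖ + 1)⁻¹, inv_pos.mpr hv, fun l hl hlε ↦ ?_⟩
  by_contra hl0
  refine hl ?_
  have hdisc (m : ℂ) (hm : m ≠ 0) (hmε : ‖m‖ < (‖v‖ + 1)⁻¹) : IsUnit (m • 1 - x) := by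
    refine isUnit_smul_one_sub_of_group_inverse hxp hpx hpv hvp hxv hvx hm
      (isUnit_one_sub_of_norm_lt_one ?_)
    have := (lt_inv_comm₀ (norm_pos_iff.mpr hm) hv).mp hmε
    calc ‖m • v‖ = ‖m‖ * ‖v‖ := norm_smul m v
      _ < ‖m‖ * (‖v‖ + 1) := by
        have := norm_pos_iff.mpr hm
        gcongr
        linarith
      _ ≤ (‖v‖ + 1)⁻¹ * (‖v‖ + 1) := by gcongr
      _ = 1 := inv_mul_cancel₀ hv.ne'
  obtain ⟨w, hwS, hzw, hwz⟩ := exists_inverse_mem_elemental (inv_pos.mpr hv) hdisc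
    (fun m ↦ isUnit_smul_one_sub_of_re_neg hpos) hl0 hlε
  refine ⟨w, mem_sup_span_one_of_mem_elemental hA hsq hx hwS, ?_, ?_⟩
  · rw [hzw, hwz, ← two_smul ℂ, smul_smul]
    norm_num
  · rw [mul_assoc, hzw, ← mul_assoc w, hwz, mul_one, one_mul, ← two_smul ℂ, smul_smul]
    norm_num
end

section
/- Let A be an approximately unital Jordan operator algebra that is a closed Jordan ideal in an (associative) operator algebra B, and let x ∈ B be real positive (x + x* ≥ 0). Then D = closure(xAx) is a hereditary subalgebra of A: D is a closed Jordan subalgebra with a Jordan contractive approximate identity satisfying yAy ⊆ D for all y ∈ D. -/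
set_option synthInstance.maxHeartbeats 1000000
set_option maxHeartbeats 1000000

/-- A Jordan contractive approximate identity for a set `S ⊆ B(H)`. -/
def IsJCaiSet15 {H : Type*} [NormedAddCommGroup H] [InnerProductSpace ℂ H]
    (S : Set (H →L[ℂ] H)) {ι : Type*} (l : Filter ι) (e : ι → H →L[ℂ] H) : Prop :=
  l.NeBot ∧ (∀ i, e i ∈ S ∧ ‖e i‖ ≤ 1) ∧
    ∀ a ∈ S, Filter.Tendsto (fun i => ((1 : ℂ) / 2) • (e i * a + a * e i)) l (nhds a)

/-- For an accretive operator `x` and `ε ≥ 0`, the operator `ε + x` dominates `x` pointwise. -/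
theorem norm_apply_le_norm_smul_add_apply {H : Type*} [NormedAddCommGroup H]
    [InnerProductSpace ℂ H] {x : H →L[ℂ] H} (hx : ∀ v, 0 ≤ (inner ℂ v (x v)).re)
    {ε : ℝ} (hε : 0 ≤ ε) (v : H) : ‖x v‖ ≤ ‖(ε : ℂ) • v + x v‖ := by
  have h := norm_add_sq (𝕜 := ℂ) ((ε : ℂ) • v) (x v)
  rw [inner_smul_left] at h
  simp only [Complex.conj_ofReal, RCLike.re_to_complex, Complex.re_ofReal_mul] at h
  refine le_of_sq_le_sq ?_ (norm_nonneg _)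
  have := mul_nonneg hε (hx v)
  nlinarith [sq_nonneg ‖(ε : ℂ) • v‖]

/-- Accretive operators are close to large multiples of the identity. -/
theorem norm_smul_one_sub_lt {H : Type*} [NormedAddCommGroup H]
    [InnerProductSpace ℂ H] {x : H →L[ℂ] H} (hx : ∀ v, 0 ≤ (inner ℂ v (x v)).re)
    {ε : ℝ} (hε : 0 < ε) :
    ∃ M : ℝ, 0 ≤ M ∧ ‖(M : ℂ) • (1 : H →L[ℂ] H) - x‖ < M + ε := by
  obtain ⟨M, hM⟩ : ∃ M : ℝ, M = ‖x‖ ^ 2 / (2 * ε) := ⟨_, rfl⟩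
  have hM0 : 0 ≤ M := by rw [hM]; positivity
  have hMx : 2 * M * ε = ‖x‖ ^ 2 := by rw [hM]; field_simp
  refine ⟨M, hM0, lt_of_le_of_lt (b := √(M ^ 2 + ‖x‖ ^ 2)) ?_ ?_⟩
  · refine ContinuousLinearMap.opNorm_le_bound _ (Real.sqrt_nonneg _) fun v => ?_
    refine le_of_sq_le_sq ?_ (by positivity)
    rw [mul_pow, Real.sq_sqrt (by positivity)]
    have h := norm_sub_sq (𝕜 := ℂ) ((M : ℂ) • v) (x v)
    rw [inner_smul_left, norm_smul] at h
    simp only [Complex.conj_ofReal, RCLike.re_to_complex, Complex.re_ofReal_mul,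
      Complex.norm_real, Real.norm_eq_abs, mul_pow, sq_abs] at h
    have h1 := mul_nonneg hM0 (hx v)
    have h2 : ‖x v‖ ^ 2 ≤ ‖x‖ ^ 2 * ‖v‖ ^ 2 := by
      rw [← mul_pow]
      exact pow_le_pow_left₀ (norm_nonneg _) (x.le_opNorm v) 2
    simp only [sub_apply, smul_apply, one_apply_eq_self]
    nlinarith
  · rw [Real.sqrt_lt' (by linarith)]
    nlinarith

/-- The resolvent of an accretive element of a closed subalgebra `B` is a left multiplier
of `B`. -/
theorem exists_resolvent_mul_mem {H : Type*} [NormedAddCommGroup H]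
    [InnerProductSpace ℂ H] [CompleteSpace H]
    {B : Submodule ℂ (H →L[ℂ] H)} (hB : IsClosed (B : Set (H →L[ℂ] H)))
    (hBmul : ∀ a ∈ B, ∀ b ∈ B, a * b ∈ B)
    {x : H →L[ℂ] H} (hxB : x ∈ B) (hx : ∀ v, 0 ≤ (inner ℂ v (x v)).re)
    {ε : ℝ} (hε : 0 < ε) :
    ∃ r : H →L[ℂ] H, (∀ b ∈ B, r * b ∈ B) ∧
      ((ε : ℂ) • 1 + x) * r = 1 ∧ r * ((ε : ℂ) • 1 + x) = 1 := by
  obtain ⟨M, hM0, hM⟩ := norm_smul_one_sub_lt hx hε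
  have hpos : 0 < M + ε := by linarith
  have hc : ((M : ℂ) + ε) ≠ 0 := by exact_mod_cast hpos.ne'
  obtain ⟨c, hcdef⟩ : ∃ c : ℂ, c = ((M : ℂ) + ε)⁻¹ := ⟨_, rfl⟩
  obtain ⟨T, hT⟩ : ∃ T : H →L[ℂ] H, T = c • ((M : ℂ) • 1 - x) := ⟨_, rfl⟩
  have hTnorm : ‖T‖ < 1 := by
    have hcn : ‖c‖ = (M + ε)⁻¹ := by
      rw [hcdef, norm_inv, ← Complex.ofReal_add, Complex.norm_real, Real.norm_of_nonneg hpos.le]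
    rw [hT, norm_smul, hcn, inv_mul_lt_iff₀ hpos]
    linarith
  have hsub : 1 - T = c • ((ε : ℂ) • 1 + x) := by
    have h1 : (1 : H →L[ℂ] H) = c • (((M : ℂ) + ε) • 1) := by
      rw [smul_smul, hcdef, inv_mul_cancel₀ hc, one_smul]
    rw [hT]
    nth_rewrite 1 [h1]
    module
  have hTB : ∀ b ∈ B, T * b ∈ B := fun b hb => by
    rw [hT, smul_mul_assoc, sub_mul, smul_mul_assoc, one_mul]
    exact B.smul_mem _ (B.sub_mem (B.smul_mem _ hb) (hBmul _ hxB _ hb))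
  have hTpow : ∀ n : ℕ, ∀ b ∈ B, T ^ n * b ∈ B := fun n => by
    induction n with
    | zero => simp
    | succ k ih => exact fun b hb => by rw [pow_succ, mul_assoc]; exact ih _ (hTB b hb)
  have hsum := summable_geometric_of_norm_lt_one hTnorm
  refine ⟨c • ∑' n, T ^ n, fun b hb => ?_, ?_, ?_⟩
  · rw [smul_mul_assoc, ← hsum.tsum_mul_right]
    exact B.smul_mem _ (hB.mem_of_tendsto (hsum.mul_right b).hasSum
      (.of_forall fun s => B.sum_mem fun n _ => hTpow n b hb))
  · rw [mul_smul_comm, ← smul_mul_assoc, ← hsub, mul_neg_geom_series T hTnorm]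
  · rw [smul_mul_assoc, ← mul_smul_comm, ← hsub, geom_series_mul_neg T hTnorm]

/-- An accretive element `x` of a closed subalgebra `B` has contractive approximate units
of the form `e = x * r = r * x` in `B`, where `r` is a scalar multiple of `1 - e`. -/
theorem exists_contractive_approx_unit {H : Type*} [NormedAddCommGroup H]
    [InnerProductSpace ℂ H] [CompleteSpace H]
    {B : Submodule ℂ (H →L[ℂ] H)} (hB : IsClosed (B : Set (H →L[ℂ] H)))
    (hBmul : ∀ a ∈ B, ∀ b ∈ B, a * b ∈ B)
    {x : H →L[ℂ] H} (hxB : x ∈ B) (hx : ∀ v, 0 ≤ (inner ℂ v (x v)).re)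
    {ε : ℝ} (hε : 0 < ε) :
    ∃ (e : H →L[ℂ] H) (c : ℂ), e ∈ B ∧ ‖e‖ ≤ 1 ∧ e = x * (c • (1 - e)) ∧ e = c • (1 - e) * x ∧
      ‖e * x - x‖ ≤ ε ∧ ‖x * e - x‖ ≤ ε := by
  obtain ⟨r, hrB, h1, h2⟩ := exists_resolvent_mul_mem hB hBmul hxB hx hε
  have hε' : (ε : ℂ) ≠ 0 := by exact_mod_cast hε.ne'
  rw [add_mul, smul_mul_assoc, one_mul] at h1
  rw [mul_add, mul_smul_comm, mul_one] at h2
  have hcomm : x * r = r * x := add_left_cancel (h1.trans h2.symm)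
  have hεr : (ε : ℂ) • r = 1 - x * r := eq_sub_of_add_eq h1
  have hr : r = (ε : ℂ)⁻¹ • (1 - x * r) := by
    rw [← hεr, smul_smul, inv_mul_cancel₀ hε', one_smul]
  have hnorm : ‖x * r‖ ≤ 1 := by
    refine ContinuousLinearMap.opNorm_le_bound _ zero_le_one fun v => ?_
    have h := norm_apply_le_norm_smul_add_apply hx hε.le (r v)
    have h3 : (ε : ℂ) • r v + x (r v) = v := DFunLike.congr_fun h1 v
    rw [h3] at h
    simpa using h
  refine ⟨x * r, (ε : ℂ)⁻¹, hcomm ▸ hrB x hxB, hnorm, by rw [← hr], by rw [← hr, hcomm], ?_, ?_⟩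
  · have : x * r * x - x = -((ε : ℂ) • (x * r)) := by
      rw [hcomm, ← smul_mul_assoc, hεr, hcomm]
      noncomm_ring
    rw [this, norm_neg, norm_smul, Complex.norm_real, Real.norm_of_nonneg hε.le]
    nlinarith
  · have : x * (x * r) - x = -((ε : ℂ) • (x * r)) := by
      rw [← mul_smul_comm, hεr]
      noncomm_ring
    rw [this, norm_neg, norm_smul, Complex.norm_real, Real.norm_of_nonneg hε.le]
    nlinarith

/-- Convergence of bounded left multiplications to the identity passes to the closure. -/
theorem tendsto_mul_of_mem_closure {R : Type*} [NormedRing R] {ι : Type*} {l : Filter ι}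
    {e : ι → R} (he : ∀ i, ‖e i‖ ≤ 1) {S : Set R}
    (h : ∀ a ∈ S, Filter.Tendsto (fun i => e i * a) l (nhds a)) {a : R} (ha : a ∈ closure S) :
    Filter.Tendsto (fun i => e i * a) l (nhds a) := by
  rw [Metric.tendsto_nhds]
  intro δ hδ
  obtain ⟨b, hb, hab⟩ := Metric.mem_closure_iff.1 ha (δ / 3) (by positivity)
  filter_upwards [Metric.tendsto_nhds.1 (h b hb) (δ / 3) (by positivity)] with i hi
  rw [dist_eq_norm] at hab hi ⊢
  have h1 : e i * a - a = e i * (a - b) + (e i * b - b) - (a - b) := by noncomm_ring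
  have h2 : ‖e i * (a - b)‖ ≤ ‖a - b‖ :=
    (norm_mul_le _ _).trans (mul_le_of_le_one_left (norm_nonneg _) (he i))
  rw [h1]
  linarith [norm_sub_le (e i * (a - b) + (e i * b - b)) (a - b),
    norm_add_le (e i * (a - b)) (e i * b - b)]

/-- Convergence of bounded right multiplications to the identity passes to the closure. -/
theorem tendsto_mul_of_mem_closure' {R : Type*} [NormedRing R] {ι : Type*} {l : Filter ι}
    {e : ι → R} (he : ∀ i, ‖e i‖ ≤ 1) {S : Set R}
    (h : ∀ a ∈ S, Filter.Tendsto (fun i => a * e i) l (nhds a)) {a : R} (ha : a ∈ closure S) :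
    Filter.Tendsto (fun i => a * e i) l (nhds a) := by
  rw [Metric.tendsto_nhds]
  intro δ hδ
  obtain ⟨b, hb, hab⟩ := Metric.mem_closure_iff.1 ha (δ / 3) (by positivity)
  filter_upwards [Metric.tendsto_nhds.1 (h b hb) (δ / 3) (by positivity)] with i hi
  rw [dist_eq_norm] at hab hi ⊢
  have h1 : a * e i - a = (a - b) * e i + (b * e i - b) - (a - b) := by noncomm_ring
  have h2 : ‖(a - b) * e i‖ ≤ ‖a - b‖ :=
    (norm_mul_le _ _).trans (mul_le_of_le_one_right (norm_nonneg _) (he i))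
  rw [h1]
  linarith [norm_sub_le ((a - b) * e i + (b * e i - b)) (a - b),
    norm_add_le ((a - b) * e i) (b * e i - b)]

/-- A Jordan approximate identity acts as a two-sided approximate identity on squares. -/
theorem tendsto_mul_sq_of_tendsto_jordan {R : Type*} [NormedRing R] [NormedAlgebra ℂ R]
    {ι : Type*} {l : Filter ι} {f : ι → R} {a : R}
    (h1 : Filter.Tendsto (fun i => ((1 : ℂ) / 2) • (f i * a + a * f i)) l (nhds a))
    (h2 : Filter.Tendsto (fun i => ((1 : ℂ) / 2) • (f i * (a * a) + a * a * f i)) l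
      (nhds (a * a))) :
    Filter.Tendsto (fun i => f i * (a * a)) l (nhds (a * a)) ∧
      Filter.Tendsto (fun i => a * a * f i) l (nhds (a * a)) := by
  have hd : Filter.Tendsto (fun i => ((1 : ℂ) / 2) • (f i * a + a * f i) * a -
      a * (((1 : ℂ) / 2) • (f i * a + a * f i))) l (nhds 0) := by
    simpa using (h1.mul_const a).sub (h1.const_mul a)
  constructor
  · have := h2.add hd
    rw [add_zero] at this
    refine this.congr fun i => ?_
    simp only [smul_mul_assoc, mul_smul_comm, add_mul, mul_add, mul_assoc]
    module
  · have := h2.sub hd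
    rw [sub_zero] at this
    refine this.congr fun i => ?_
    simp only [smul_mul_assoc, mul_smul_comm, add_mul, mul_add, mul_assoc]
    module

/-- A Jordan contractive approximate identity of a Jordan algebra of operators is a two-sided
approximate identity. -/
theorem IsJCaiSet15.tendsto_mul {H : Type*} [NormedAddCommGroup H] [InnerProductSpace ℂ H]
    {A : Submodule ℂ (H →L[ℂ] H)} (hsq : ∀ a ∈ A, a * a ∈ A) {ι : Type*} {l : Filter ι}
    {f : ι → H →L[ℂ] H} (hf : IsJCaiSet15 (A : Set (H →L[ℂ] H)) l f) {a : H →L[ℂ] H}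
    (ha : a ∈ A) :
    Filter.Tendsto (fun i => f i * a) l (nhds a) ∧
      Filter.Tendsto (fun i => a * f i) l (nhds a) := by
  obtain ⟨hl, hfA, hlim⟩ := hf
  have hS : ∀ b ∈ A, Filter.Tendsto (fun i => f i * (b * b)) l (nhds (b * b)) ∧
      Filter.Tendsto (fun i => b * b * f i) l (nhds (b * b)) := fun b hb =>
    tendsto_mul_sq_of_tendsto_jordan (hlim b hb) (hlim _ (hsq b hb))
  have hcl : a ∈ closure (Set.range fun j => ((1 : ℂ) / 2) • (f j * a + a * f j)) :=
    mem_closure_of_tendsto (hlim a ha) (.of_forall fun j => ⟨j, rfl⟩)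
  have hpol (j : ι) : f j * a + a * f j = (f j + a) * (f j + a) - f j * f j - a * a := by
    noncomm_ring
  constructor
  · refine tendsto_mul_of_mem_closure (fun i => (hfA i).2) ?_ hcl
    rintro _ ⟨j, rfl⟩
    simp only [hpol, mul_smul_comm, mul_sub _ _ (a * a), mul_sub _ _ (f j * f j)]
    exact (((hS _ (A.add_mem (hfA j).1 ha)).1.sub (hS _ (hfA j).1).1).sub
      (hS a ha).1).const_smul _
  · refine tendsto_mul_of_mem_closure' (fun i => (hfA i).2) ?_ hcl
    rintro _ ⟨j, rfl⟩
    simp only [hpol, smul_mul_assoc, sub_mul _ (a * a), sub_mul _ (f j * f j)]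
    exact (((hS _ (A.add_mem (hfA j).1 ha)).2.sub (hS _ (hfA j).1).2).sub
      (hS a ha).2).const_smul _

/-- Two-sided products `e * f * e` act as approximate left units. -/
theorem norm_mul_mul_mul_sub_le {R : Type*} [NormedRing R] {e f : R} (he : ‖e‖ ≤ 1)
    (hf : ‖f‖ ≤ 1) (y : R) :
    ‖e * f * e * y - y‖ ≤ 2 * ‖e * y - y‖ + ‖f * y - y‖ := by
  have h1 : e * f * e * y - y = e * f * (e * y - y) + e * (f * y - y) + (e * y - y) := by
    noncomm_ring
  have h2 : ‖e * f * (e * y - y)‖ ≤ ‖e * y - y‖ :=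
    (norm_mul_le _ _).trans (mul_le_of_le_one_left (norm_nonneg _)
      ((norm_mul_le _ _).trans (mul_le_one₀ he (norm_nonneg _) hf)))
  have h3 : ‖e * (f * y - y)‖ ≤ ‖f * y - y‖ :=
    (norm_mul_le _ _).trans (mul_le_of_le_one_left (norm_nonneg _) he)
  rw [h1]
  linarith [norm_add₃_le (a := e * f * (e * y - y)) (b := e * (f * y - y)) (c := e * y - y)]

/-- Two-sided products `e * f * e` act as approximate right units. -/
theorem norm_mul_mul_mul_sub_le' {R : Type*} [NormedRing R] {e f : R} (he : ‖e‖ ≤ 1)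
    (hf : ‖f‖ ≤ 1) (y : R) :
    ‖y * (e * f * e) - y‖ ≤ 2 * ‖y * e - y‖ + ‖y * f - y‖ := by
  have h1 : y * (e * f * e) - y = (y * e - y) * (f * e) + (y * f - y) * e + (y * e - y) := by
    noncomm_ring
  have h2 : ‖(y * e - y) * (f * e)‖ ≤ ‖y * e - y‖ :=
    (norm_mul_le _ _).trans (mul_le_of_le_one_right (norm_nonneg _)
      ((norm_mul_le _ _).trans (mul_le_one₀ hf (norm_nonneg _) he)))
  have h3 : ‖(y * f - y) * e‖ ≤ ‖y * f - y‖ :=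
    (norm_mul_le _ _).trans (mul_le_of_le_one_right (norm_nonneg _) he)
  rw [h1]
  linarith [norm_add₃_le (a := (y * e - y) * (f * e)) (b := (y * f - y) * e) (c := y * e - y)]

/-- A subspace closed under Jordan products with two elements `b`, `b * b` is closed under
`a ↦ b * a * b`. -/
theorem Submodule.mul_mul_mem_of_jordan {R : Type*} [Ring R] [Algebra ℂ R] {A : Submodule ℂ R}
    {a b : R} (h1 : (a * b + b * a) * b + b * (a * b + b * a) ∈ A)
    (h2 : a * (b * b) + b * b * a ∈ A) : b * a * b ∈ A := by
  have h := A.smul_mem ((1 : ℂ) / 2) (A.sub_mem h1 h2)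
  convert h using 1
  simp only [add_mul, mul_add, mul_assoc]
  module

/-- If the approximately unital Jordan operator algebra `A` is a closed Jordan
ideal in an operator algebra `B` and `x ∈ B` is real positive, then
`D = closure (xAx)` is a hereditary subalgebra of `A`: a closed Jordan
subalgebra of `A` with a Jordan cai such that `yAy ⊆ D` for all `y ∈ D`. -/
theorem stmt15 {H : Type*} [NormedAddCommGroup H] [InnerProductSpace ℂ H] [CompleteSpace H]
    (B : Submodule ℂ (H →L[ℂ] H)) (hB : IsClosed (B : Set (H →L[ℂ] H)))
    (hBmul : ∀ a ∈ B, ∀ b ∈ B, a * b ∈ B)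
    (A : Submodule ℂ (H →L[ℂ] H)) (hAB : A ≤ B) (hA : IsClosed (A : Set (H →L[ℂ] H)))
    (hsq : ∀ a ∈ A, a * a ∈ A)
    (hideal : ∀ a ∈ A, ∀ b ∈ B, a * b + b * a ∈ A)
    (hcai : ∃ (ι : Type) (l : Filter ι) (e : ι → H →L[ℂ] H),
      IsJCaiSet15 (A : Set (H →L[ℂ] H)) l e)
    (x : H →L[ℂ] H) (hx : x ∈ B) (hpos : (x + star x).IsPositive) :
    closure {z : H →L[ℂ] H | ∃ a ∈ A, z = x * a * x} ⊆ (A : Set (H →L[ℂ] H)) ∧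
    (∀ y ∈ closure {z : H →L[ℂ] H | ∃ a ∈ A, z = x * a * x},
      ∀ y' ∈ closure {z : H →L[ℂ] H | ∃ a ∈ A, z = x * a * x},
        y + y' ∈ closure {z : H →L[ℂ] H | ∃ a ∈ A, z = x * a * x}) ∧
    (∀ (c : ℂ), ∀ y ∈ closure {z : H →L[ℂ] H | ∃ a ∈ A, z = x * a * x},
      c • y ∈ closure {z : H →L[ℂ] H | ∃ a ∈ A, z = x * a * x}) ∧
    (∀ y ∈ closure {z : H →L[ℂ] H | ∃ a ∈ A, z = x * a * x},
      y * y ∈ closure {z : H →L[ℂ] H | ∃ a ∈ A, z = x * a * x}) ∧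
    (∃ (ι : Type) (l : Filter ι) (e : ι → H →L[ℂ] H),
      IsJCaiSet15 (closure {z : H →L[ℂ] H | ∃ a ∈ A, z = x * a * x}) l e) ∧
    (∀ y ∈ closure {z : H →L[ℂ] H | ∃ a ∈ A, z = x * a * x}, ∀ a ∈ A,
      y * a * y ∈ closure {z : H →L[ℂ] H | ∃ a ∈ A, z = x * a * x}) := by
  have hacc : ∀ v, 0 ≤ (inner ℂ v (x v)).re := fun v => by
    have h : 0 ≤ (inner ℂ v ((x + star x) v)).re := hpos.re_inner_nonneg_right v
    rw [add_apply, inner_add_right, ContinuousLinearMap.star_eq_adjoint,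
      ContinuousLinearMap.adjoint_inner_right, Complex.add_re, ← inner_conj_symm (x v) v,
      Complex.conj_re] at h
    linarith
  have hbab : ∀ a ∈ A, ∀ b ∈ B, b * a * b ∈ A := fun a ha b hb =>
    Submodule.mul_mul_mem_of_jordan (hideal _ (hideal a ha b hb) b hb)
      (hideal a ha _ (hBmul b hb b hb))
  have haba : ∀ a ∈ A, ∀ b ∈ B, a * b * a ∈ A := fun a ha b hb =>
    Submodule.mul_mul_mem_of_jordan
      (hideal _ (by rw [add_comm]; exact hideal a ha b hb) a (hAB ha))
      (by rw [add_comm]; exact hideal _ (hsq a ha) b hb)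
  obtain ⟨D, hD⟩ : ∃ D : Set (H →L[ℂ] H), D = {z : H →L[ℂ] H | ∃ a ∈ A, z = x * a * x} :=
    ⟨_, rfl⟩
  rw [← hD]
  have hDmem : ∀ a ∈ A, x * a * x ∈ D := fun a ha => by rw [hD]; exact ⟨a, ha, rfl⟩
  have hDA : D ⊆ (A : Set (H →L[ℂ] H)) := by
    rw [hD]
    rintro _ ⟨a, ha, rfl⟩
    exact hbab a ha x hx
  have hDind : ∀ {z}, z ∈ D → ∃ a ∈ A, z = x * a * x := fun {z} hz => by rwa [hD] at hz
  refine ⟨closure_minimal hDA hA, fun y hy y' hy' => ?_, fun c y hy => ?_, fun y hy => ?_, ?_,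
    fun y hy a ha => ?_⟩
  · refine map_mem_closure₂ continuous_add hy hy' fun z hz z' hz' => ?_
    obtain ⟨a, ha, rfl⟩ := hDind hz
    obtain ⟨a', ha', rfl⟩ := hDind hz'
    rw [← add_mul, ← mul_add]
    exact hDmem _ (A.add_mem ha ha')
  · refine map_mem_closure (continuous_const_smul c) hy fun z hz => ?_
    obtain ⟨a, ha, rfl⟩ := hDind hz
    rw [← smul_mul_assoc, ← mul_smul_comm]
    exact hDmem _ (A.smul_mem c ha)
  · refine map_mem_closure (f := fun y => y * y) (by fun_prop) hy fun z hz => ?_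
    obtain ⟨a, ha, rfl⟩ := hDind hz
    simpa only [mul_assoc] using hDmem _ (haba a ha _ (hBmul x hx x hx))
  · obtain ⟨ι, l, f, hf⟩ := hcai
    choose e c heB he1 hexr herx hex hxe using fun n : ℕ =>
      exists_contractive_approx_unit hB hBmul hx hacc (Nat.one_div_pos_of_nat (α := ℝ) (n := n))
    have hmem (n : ℕ) {a : H →L[ℂ] H} (ha : a ∈ A) : e n * a * e n ∈ D := by
      have h : (c n • (1 - e n)) * a * (c n • (1 - e n)) ∈ A := by
        have h1 : (c n • (1 - e n)) * a * (c n • (1 - e n)) =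
            (c n * c n) • (a - (a * e n + e n * a) + e n * a * e n) := by
          rw [smul_mul_assoc, smul_mul_assoc, mul_smul_comm, smul_smul]
          congr 1
          noncomm_ring
        rw [h1]
        exact A.smul_mem _ (A.add_mem (A.sub_mem ha (hideal a ha _ (heB n)))
          (hbab a ha _ (heB n)))
      have h2 : e n * a * e n = x * ((c n • (1 - e n)) * a * (c n • (1 - e n))) * x := by
        calc e n * a * e n = x * (c n • (1 - e n)) * a * (c n • (1 - e n) * x) := by
              rw [← hexr, ← herx]
          _ = _ := by simp only [mul_assoc]
      rw [h2]
      exact hDmem _ h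
    have hlimx : Filter.Tendsto (fun n => e n * x) Filter.atTop (nhds x) :=
      tendsto_iff_norm_sub_tendsto_zero.2
        (squeeze_zero (fun _ => norm_nonneg _) hex tendsto_one_div_add_atTop_nhds_zero_nat)
    have hxlim : Filter.Tendsto (fun n => x * e n) Filter.atTop (nhds x) :=
      tendsto_iff_norm_sub_tendsto_zero.2
        (squeeze_zero (fun _ => norm_nonneg _) hxe tendsto_one_div_add_atTop_nhds_zero_nat)
    have hgnorm : ∀ p : ι × ℕ, ‖e p.2 * f p.1 * e p.2‖ ≤ 1 := fun p =>
      (norm_mul_le _ _).trans (mul_le_one₀ ((norm_mul_le _ _).trans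
        (mul_le_one₀ (he1 _) (norm_nonneg _) (hf.2.1 _).2)) (norm_nonneg _) (he1 _))
    have hleft : ∀ y ∈ D, Filter.Tendsto (fun p : ι × ℕ => e p.2 * f p.1 * e p.2 * y)
        (l ×ˢ Filter.atTop) (nhds y) := fun y hy => by
      have h1 : Filter.Tendsto (fun n => e n * y) Filter.atTop (nhds y) := by
        obtain ⟨a, ha, rfl⟩ := hDind hy
        simpa only [mul_assoc] using hlimx.mul_const (a * x)
      have h2 := ((tendsto_iff_norm_sub_tendsto_zero.1 h1).comp
        (Filter.tendsto_snd (f := l))).const_mul 2 |>.add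
        ((tendsto_iff_norm_sub_tendsto_zero.1 (hf.tendsto_mul hsq (hDA hy)).1).comp
          (Filter.tendsto_fst (g := Filter.atTop (α := ℕ))))
      rw [mul_zero, add_zero] at h2
      exact tendsto_iff_norm_sub_tendsto_zero.2 (squeeze_zero (fun _ => norm_nonneg _)
        (fun p => norm_mul_mul_mul_sub_le (he1 p.2) (hf.2.1 p.1).2 y) h2)
    have hright : ∀ y ∈ D, Filter.Tendsto (fun p : ι × ℕ => y * (e p.2 * f p.1 * e p.2))
        (l ×ˢ Filter.atTop) (nhds y) := fun y hy => by
      have h1 : Filter.Tendsto (fun n => y * e n) Filter.atTop (nhds y) := by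
        obtain ⟨a, ha, rfl⟩ := hDind hy
        simpa only [mul_assoc] using hxlim.const_mul (x * a)
      have h2 := ((tendsto_iff_norm_sub_tendsto_zero.1 h1).comp
        (Filter.tendsto_snd (f := l))).const_mul 2 |>.add
        ((tendsto_iff_norm_sub_tendsto_zero.1 (hf.tendsto_mul hsq (hDA hy)).2).comp
          (Filter.tendsto_fst (g := Filter.atTop (α := ℕ))))
      rw [mul_zero, add_zero] at h2
      exact tendsto_iff_norm_sub_tendsto_zero.2 (squeeze_zero (fun _ => norm_nonneg _)
        (fun p => norm_mul_mul_mul_sub_le' (he1 p.2) (hf.2.1 p.1).2 y) h2)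
    have := hf.1
    refine ⟨ι × ℕ, l ×ˢ Filter.atTop, fun p => e p.2 * f p.1 * e p.2, inferInstance,
      fun p => ⟨subset_closure (hmem p.2 (hf.2.1 p.1).1), hgnorm p⟩, fun y hy => ?_⟩
    have h := ((tendsto_mul_of_mem_closure hgnorm hleft hy).add
      (tendsto_mul_of_mem_closure' hgnorm hright hy)).const_smul ((1 : ℂ) / 2)
    rwa [show ((1 : ℂ) / 2) • (y + y) = y by module] at h
  · refine map_mem_closure (f := fun y => y * a * y) (by fun_prop) hy fun z hz => ?_
    obtain ⟨b, hb, rfl⟩ := hDind hz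
    simpa only [mul_assoc] using hDmem _ (haba b hb _ (hAB (hbab a ha x hx)))
end
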